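/- arXiv:2411.11460 — 3 statements merged into one kernel-verified Lean document; each statement's English description precedes it below -/
import Mathlib

section
/- Let G be a finite commutative group and let B : G × G → ℂˣ be a bilinear pairing that is alternating (B(g, g) = 1 for all g ∈ G) and nondegenerate (g ↦ B(g, ·) is injective into Hom(G, ℂˣ)). Then there exist subgroups J and K of G such that: (1) G is the internal direct product of J and K (J ∩ K = {1} and JK = G); (2) J = {g ∈ G : B(g, j) = 1 for all j ∈ J} and K = {g ∈ G : B(g, k) = 1 for all k ∈ K}, i.e. both J and K are maximal isotropic; and (3) the map k ↦ B(k, ·)|_J is a group isomorphism from K onto the character group Hom(J, ℂˣ). -/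
theorem stmt4_core {G : Type*} [CommGroup G] [Fintype G] (F : G →* G →* ℂˣ)
    (halt : ∀ g, F g g = 1) (hsk : ∀ g h, F g h * F h g = 1) :
    ∀ (n : ℕ) (H : Subgroup G), Nat.card H = n →
      (∀ h ∈ H, (∀ x ∈ H, F h x = 1) → h = 1) →
      ∃ J K : Subgroup G, J ⊔ K = H ∧ (∀ x ∈ J, ∀ y ∈ J, F x y = 1) ∧
        (∀ x ∈ K, ∀ y ∈ K, F x y = 1) := by
  intro n
  induction n using Nat.strong_induction_on with
  | _ n ih =>
  intro H hcard hH
  by_cases hbot : H = ⊥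
  · subst hbot
    refine ⟨⊥, ⊥, by simp, ?_, ?_⟩ <;> simp
  have hsk' : ∀ g h, F g h = 1 → F h g = 1 := by
    intro g h e
    simpa [e] using hsk g h
  obtain ⟨⟨a, haH⟩, ha⟩ := Monoid.exists_orderOf_eq_exponent
    (Monoid.ExponentExists.of_finite (G := H))
  set m := Monoid.exponent H with hm
  have hpow : ∀ h ∈ H, h ^ m = 1 := by
    intro h hh
    have := Monoid.pow_exponent_eq_one (⟨h, hh⟩ : H)
    simpa using congrArg (Subtype.val) this
  rw [Subgroup.orderOf_mk] at ha
  have hm0 : m ≠ 0 := by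
    rw [← ha]; exact (orderOf_pos a).ne'
  have hm1 : m ≠ 1 := by
    intro h1
    apply hbot
    rw [Subgroup.eq_bot_iff_forall]
    intro x hx
    simpa [h1] using hpow x hx
  -- find b
  obtain ⟨b, hbH, hb⟩ : ∃ b ∈ H, IsPrimitiveRoot (F a b) m := by
    let χ : H →* ℂˣ := (F a).comp H.subtype
    have : Finite χ.range := (Set.finite_range χ).to_subtype
    have : IsCyclic χ.range := inferInstance
    obtain ⟨⟨z, ⟨b, hbH⟩, hz⟩, hgen⟩ := IsCyclic.exists_generator (α := χ.range)
    have hz' : F a b = z := hz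
    refine ⟨b, hbH, ?_⟩
    have e1 : F a b ^ m = 1 := by rw [← map_pow, hpow b hbH, map_one]
    refine ⟨e1, ?_⟩
    intro l hl
    rw [← ha]
    apply orderOf_dvd_of_pow_eq_one
    apply hH _ (H.pow_mem haH l)
    intro x hx
    obtain ⟨k, hk⟩ := Subgroup.mem_zpowers_iff.1 (hgen ⟨χ ⟨x, hx⟩, ⟨_, rfl⟩⟩)
    have hk' : z ^ k = F a x := by simpa [χ] using congrArg Subtype.val hk
    rw [map_pow, MonoidHom.pow_apply, ← hk', ← hz', ← zpow_natCast, ← zpow_mul, mul_comm, zpow_mul,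
      zpow_natCast, hl, one_zpow]
  have : NeZero m := ⟨hm0⟩
  have hroot : ∀ x y, y ∈ H → ∃ i : ℕ, F a b ^ i = F x y := by
    intro x y hy
    have e1 : F x y ^ m = 1 := by rw [← map_pow, hpow y hy, map_one]
    have hb' : IsPrimitiveRoot ((F a b : ℂˣ) : ℂ) m := IsPrimitiveRoot.coe_units_iff.2 hb
    obtain ⟨i, -, hi⟩ := hb'.eq_pow_of_pow_eq_one (ξ := ((F x y : ℂˣ) : ℂ)) (by
      rw [← Units.val_pow_eq_pow_val, e1, Units.val_one])
    exact ⟨i, by exact_mod_cast hi⟩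
  let H' : Subgroup G := H ⊓ ((F a).ker ⊓ (F b).ker)
  have memH' : ∀ x, x ∈ H' ↔ x ∈ H ∧ F a x = 1 ∧ F b x = 1 := by
    intro x; simp [H', Subgroup.mem_inf, MonoidHom.mem_ker]
  have hdec : ∀ h ∈ H, ∃ i j : ℕ, ∃ h' ∈ H', h = a ^ (-(j:ℤ)) * b ^ i * h' := by
    intro h hh
    obtain ⟨i, hi⟩ := hroot a h hh
    obtain ⟨j, hj⟩ := hroot b h hh
    refine ⟨i, j, a ^ j * (b ^ i)⁻¹ * h, ?_, ?_⟩
    · rw [memH']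
      refine ⟨H.mul_mem (H.mul_mem (H.pow_mem haH _) (H.inv_mem (H.pow_mem hbH _))) hh, ?_, ?_⟩
      · simp [halt, ← hi]
      · simp only [map_mul, map_pow, map_inv, halt, ← hj, one_pow, inv_one, mul_one]
        rw [← mul_pow, hsk, one_pow]
    · rw [zpow_neg, zpow_natCast]
      rw [mul_comm (a ^ j) (b ^ i)⁻¹]
      group
  have hlt : Nat.card H' < n := by
    rw [← hcard]
    have hle : H' ≤ H := inf_le_left
    refine lt_of_le_of_ne (Subgroup.card_le_of_le hle) ?_
    intro e
    have : H' = H := Subgroup.eq_of_le_of_card_ge hle e.ge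
    have hb1 : F a b = 1 := ((memH' b).1 (this ▸ hbH)).2.1
    rw [hb1] at hb
    exact hm1 (hb.unique IsPrimitiveRoot.one)
  obtain ⟨J, K, hJK, hJ, hK⟩ := ih _ hlt H' rfl (by
    intro h hh hx
    obtain ⟨h1, h2, h3⟩ := (memH' h).1 hh
    apply hH h h1
    intro x hxH
    obtain ⟨i, j, h', hh', rfl⟩ := hdec x hxH
    simp [hx h' hh', hsk' _ _ h2, hsk' _ _ h3])
  have hJH : J ≤ H' := hJK ▸ le_sup_left
  have hKH : K ≤ H' := hJK ▸ le_sup_right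
  have key : ∀ (c : G) (L : Subgroup G), (∀ x ∈ L, F c x = 1) → (∀ x ∈ L, ∀ y ∈ L, F x y = 1) →
      ∀ x ∈ Subgroup.zpowers c ⊔ L, ∀ y ∈ Subgroup.zpowers c ⊔ L, F x y = 1 := by
    intro c L h1 h2 x hx y hy
    obtain ⟨_, ⟨i, rfl⟩, u, hu, rfl⟩ := Subgroup.mem_sup.1 hx
    obtain ⟨_, ⟨j, rfl⟩, v, hv, rfl⟩ := Subgroup.mem_sup.1 hy
    simp [halt, h1 v hv, hsk' _ _ (h1 u hu), h2 u hu v hv]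
  refine ⟨Subgroup.zpowers a ⊔ J, Subgroup.zpowers b ⊔ K, ?_,
    key a J (fun x hx => ((memH' x).1 (hJH hx)).2.1) hJ,
    key b K (fun x hx => ((memH' x).1 (hKH hx)).2.2) hK⟩
  have hle : H' ≤ H := inf_le_left
  apply le_antisymm
  · refine sup_le (sup_le ?_ (hJH.trans hle)) (sup_le ?_ (hKH.trans hle))
    · simpa using haH
    · simpa using hbH
  · intro h hh
    obtain ⟨i, j, h', hh', rfl⟩ := hdec h hh
    rw [sup_sup_sup_comm, hJK]
    refine Subgroup.mul_mem_sup (Subgroup.mul_mem_sup ?_ ?_) hh'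
    · exact Subgroup.zpow_mem_zpowers _ _
    · exact Subgroup.npow_mem_zpowers _ _


/-- If `B` is an alternating nondegenerate bilinear pairing on a finite commutative group `G`
with values in `ℂˣ`, then `G` is the internal direct product of two maximal isotropic
subgroups `J` and `K`, and `k ↦ B(k,·)|_J` is a group isomorphism from `K` onto the
character group `Hom(J, ℂˣ)`. -/
theorem stmt4 (G : Type*) [CommGroup G] [Fintype G]
    (B : G → G → ℂˣ)
    (hBl : ∀ g h k, B (g * h) k = B g k * B h k)
    (hBr : ∀ g h k, B g (h * k) = B g h * B g k)
    (halt : ∀ g, B g g = 1)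
    (hnd : Function.Injective fun g => (B g : G → ℂˣ)) :
    ∃ J K : Subgroup G,
      (J ⊓ K = ⊥ ∧ J ⊔ K = ⊤) ∧
      ((J : Set G) = {g : G | ∀ j ∈ J, B g j = 1}) ∧
      ((K : Set G) = {g : G | ∀ k ∈ K, B g k = 1}) ∧
      ∃ e : K ≃* (J →* ℂˣ), ∀ (k : K) (j : J), e k j = B (k : G) (j : G) := by
  let F : G →* G →* ℂˣ := MonoidHom.mk' (fun g => MonoidHom.mk' (B g) (hBr g))
    (fun g h => MonoidHom.ext (hBl g h))
  have hF : ∀ g h, F g h = B g h := fun _ _ => rfl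
  have halt' : ∀ g, F g g = 1 := halt
  have hsk : ∀ g h, F g h * F h g = 1 := by
    intro g h
    have := halt' (g * h)
    simpa [halt'] using this
  have hsk' : ∀ g h, F g h = 1 → F h g = 1 := by
    intro g h e
    simpa [e] using hsk g h
  have hnd' : ∀ h, (∀ x, F h x = 1) → h = 1 := by
    intro h hx
    apply hnd
    funext x
    have h1 : F 1 x = 1 := by simp
    exact (hx x).trans h1.symm
  obtain ⟨J, K, hJK, hJ, hK⟩ := stmt4_core F halt' hsk _ ⊤ rfl
    (fun h _ hx => hnd' h fun x => hx x trivial)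
  have hone : ∀ x, (∀ j ∈ J, F x j = 1) → (∀ k ∈ K, F x k = 1) → x = 1 := by
    intro x h1 h2
    apply hnd'
    intro y
    obtain ⟨j, hj, k, hk, rfl⟩ := Subgroup.mem_sup.1 (hJK ▸ Subgroup.mem_top y : y ∈ J ⊔ K)
    simp [h1 j hj, h2 k hk]
  let φ : ∀ A C : Subgroup G, A →* (C →* ℂˣ) := fun A C =>
    MonoidHom.mk' (fun k => (F k).comp C.subtype) (fun k l => by ext; simp)
  have hφ : ∀ (A C : Subgroup G) (k : A) (j : C), φ A C k j = F k j := fun _ _ _ _ => rfl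
  have i1 : Function.Injective (φ K J) := by
    rw [injective_iff_map_eq_one]
    intro k hk
    apply Subtype.ext
    apply hone
    · intro j hj
      simpa [hφ] using DFunLike.congr_fun hk ⟨j, hj⟩
    · exact hK _ k.2
  have i2 : Function.Injective (φ J K) := by
    rw [injective_iff_map_eq_one]
    intro k hk
    apply Subtype.ext
    apply hone
    · exact hJ _ k.2
    · intro j hj
      simpa [hφ] using DFunLike.congr_fun hk ⟨j, hj⟩
  have c1 := CommGroup.card_monoidHom_of_hasEnoughRootsOfUnity J ℂ
  have c2 := CommGroup.card_monoidHom_of_hasEnoughRootsOfUnity K ℂ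
  have : Finite (J →* ℂˣ) := Nat.finite_of_card_ne_zero (by rw [c1]; exact Nat.card_pos.ne')
  have : Finite (K →* ℂˣ) := Nat.finite_of_card_ne_zero (by rw [c2]; exact Nat.card_pos.ne')
  have l2 := Nat.card_le_card_of_injective _ i2
  have bij : Function.Bijective (φ K J) :=
    i1.bijective_of_nat_card_le (by rw [c1]; rw [c2] at l2; exact l2)
  refine ⟨J, K, ⟨?_, hJK⟩, ?_, ?_, MulEquiv.ofBijective (φ K J) bij, fun k j => rfl⟩
  · rw [Subgroup.eq_bot_iff_forall]
    intro x hx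
    exact hone x (hJ x hx.1) (hK x hx.2)
  · ext g
    refine ⟨fun hg => hJ g hg, fun hg => ?_⟩
    obtain ⟨j, hj, k, hk, rfl⟩ := Subgroup.mem_sup.1 (hJK ▸ Subgroup.mem_top g : g ∈ J ⊔ K)
    have : k = 1 := by
      refine hone k (fun x hx => ?_) (hK k hk)
      have h1 : F (j * k) x = 1 := hg x hx
      simpa [hJ j hj x hx] using h1
    subst this
    simpa using hj
  · ext g
    refine ⟨fun hg => hK g hg, fun hg => ?_⟩
    obtain ⟨j, hj, k, hk, rfl⟩ := Subgroup.mem_sup.1 (hJK ▸ Subgroup.mem_top g : g ∈ J ⊔ K)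
    have : j = 1 := by
      refine hone j (hJ j hj) (fun x hx => ?_)
      have h1 : F (j * k) x = 1 := hg x hx
      simpa [hK k hk x hx] using h1
    subst this
    simpa using hk
end

section
/- Let p be an odd prime, let n be an odd positive integer divisible by p, and let F be a finite extension of ℚ_p containing n distinct n-th roots of unity. Let θ be a ramified quadratic character of Fˣ. Then there are only finitely many characters η of Fˣ with ηⁿ = 1, and they satisfy Σ_{η : ηⁿ = 1} q^{−e(θη)} = n² · q^{−1}. -/
/-- The ring of integers of `F`: the integral closure of `ℤ_[p]` in `F`. -/
noncomputable def ringOfInt (p : ℕ) [Fact p.Prime] (F : Type*) [Field F] [Algebra ℚ_[p] F] :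
    Subring F :=
  letI : Algebra ℤ_[p] F := ((algebraMap ℚ_[p] F).comp (algebraMap ℤ_[p] ℚ_[p])).toAlgebra
  (integralClosure ℤ_[p] F).toSubring

/-- A character `χ : Fˣ → ℂˣ` is unramified (with respect to the subring `O` of `F`)
if it is trivial on the unit group `Oˣ`, viewed inside `Fˣ`. -/
def IsUnramifiedChar {F : Type*} [Field F] (O : Subring F) (χ : Fˣ →* ℂˣ) : Prop :=
  ∀ u : Fˣ, (u : F) ∈ O → ((u⁻¹ : Fˣ) : F) ∈ O → χ u = 1

/-- A character `χ : Fˣ → ℂˣ` is trivial on the subgroup `1 + 𝔪^k`. -/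
def TrivOnOneAdd {F : Type*} [Field F] {O : Subring F} (𝔪 : Ideal O) (k : ℕ)
    (χ : Fˣ →* ℂˣ) : Prop :=
  ∀ u : Fˣ, (∃ m ∈ 𝔪 ^ k, ((m : F) = (u : F) - 1)) → χ u = 1

open scoped Classical in
/-- The conductor `e(χ)` of a character `χ : Fˣ → ℂˣ`: it is `0` if `χ` is unramified, and
otherwise the least `k ≥ 1` such that `χ` is trivial on `1 + 𝔪^k`. -/
noncomputable def conductorChar {F : Type*} [Field F] (O : Subring F) (𝔪 : Ideal O)
    (χ : Fˣ →* ℂˣ) : ℕ :=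
  if IsUnramifiedChar O χ then 0 else sInf {k : ℕ | 1 ≤ k ∧ TrivOnOneAdd 𝔪 k χ}

section helpers
open IsLocalRing

lemma cqp (R : Type*) [CommRing R] [IsDomain R] [IsDiscreteValuationRing R] (k : ℕ) :
    Nat.card (R ⧸ maximalIdeal R ^ k) = Nat.card (R ⧸ maximalIdeal R) ^ k := by
  have := cardQuot_pow_of_prime (P := maximalIdeal R) (IsDiscreteValuationRing.not_a_field R) (i := k)
  simpa [Submodule.cardQuot_apply] using this

lemma finq (R : Type*) [CommRing R] [IsDomain R] [IsDiscreteValuationRing R]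
    [Finite (R ⧸ maximalIdeal R)] (k : ℕ) : Finite (R ⧸ maximalIdeal R ^ k) := by
  apply Nat.finite_of_card_ne_zero
  rw [cqp]
  have : Nonempty (R ⧸ maximalIdeal R) := ⟨0⟩
  exact pow_ne_zero _ (Nat.card_pos).ne'

/-- number of `n`-th roots of unity in `R/m^k` -/
noncomputable def rootCount (R : Type*) [CommRing R] [IsLocalRing R] (n k : ℕ) : ℕ :=
  Nat.card {x : R ⧸ maximalIdeal R ^ k // x ^ n = 1}

open Classical in
lemma card_fib {A B : Type*} [Ring A] [Ring B] [Fintype A] [Fintype B] (f : A →+* B)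
    (hf : Function.Surjective f) (P : B → Prop) :
    (Finset.univ.filter (fun a => P (f a))).card * Fintype.card B =
      Fintype.card A * (Finset.univ.filter P).card := by
  set c := (Finset.univ.filter (fun a => f a = 0)).card with hc
  have h1 : ∀ b, (Finset.univ.filter (fun a => f a = b)).card = c := fun b =>
    AddMonoidHom.card_fiber_eq_of_mem_range f (hf b) (hf 0)
  have key : ∀ Q : B → Prop, (Finset.univ.filter (fun a => Q (f a))).card =
      (Finset.univ.filter Q).card * c := by
    intro Q
    rw [Finset.card_eq_sum_card_fiberwise (f := f) (t := Finset.univ.filter Q)]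
    · rw [Finset.sum_congr rfl (g := fun _ => c)]
      · simp
      · intro b hb
        rw [← h1 b, Finset.filter_filter]
        congr 1
        ext a
        simp only [Finset.mem_filter, Finset.mem_univ, true_and] at hb ⊢
        constructor
        · exact fun h => h.2
        · rintro rfl; exact ⟨hb, rfl⟩
    · intro a ha
      simpa using ha
  have h2 := key (fun _ => True)
  simp only [Finset.filter_true, Finset.card_univ] at h2
  rw [key P, h2]; ring

section
variable {R : Type*} [CommRing R] [IsDomain R] [IsDiscreteValuationRing R]

open Classical in
/-- truncated valuation -/
noncomputable def wv (L : ℕ) (a : R) : ℕ :=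
  ∑ k ∈ Finset.Icc 1 L, if a ∈ maximalIdeal R ^ k then 1 else 0

lemma mem_pow_iff_addVal (a : R) (k : ℕ) :
    a ∈ maximalIdeal R ^ k ↔ (k : ℕ∞) ≤ IsDiscreteValuationRing.addVal R a := by
  obtain ⟨ϖ, hϖ⟩ := IsDiscreteValuationRing.exists_irreducible R
  rw [hϖ.maximalIdeal_eq, Ideal.span_singleton_pow, Ideal.mem_span_singleton,
    ← IsDiscreteValuationRing.addVal_le_iff_dvd, hϖ.addVal_pow]

lemma wv_le (L : ℕ) (a : R) : wv L a ≤ L := by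
  classical
  unfold wv
  calc _ ≤ ∑ k ∈ Finset.Icc 1 L, 1 := Finset.sum_le_sum (fun i _ => by split_ifs <;> simp)
    _ = L := by simp

lemma wv_cast (L : ℕ) (a : R) (h : a ∉ maximalIdeal R ^ L) :
    (wv L a : ℕ∞) = IsDiscreteValuationRing.addVal R a := by
  classical
  rw [mem_pow_iff_addVal, not_le] at h
  obtain ⟨v, hv⟩ := ENat.ne_top_iff_exists.mp h.ne_top
  rw [← hv] at h ⊢
  have hvL : v < L := by exact_mod_cast h
  congr 1
  unfold wv
  simp_rw [mem_pow_iff_addVal, ← hv, Nat.cast_le]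
  rw [← Finset.sum_filter]
  have : Finset.filter (fun k => k ≤ v) (Finset.Icc 1 L) = Finset.Icc 1 v := by
    ext k; simp; omega
  rw [this]; simp

lemma addVal_prod {ι : Type*} (s : Finset ι) (a : ι → R) :
    IsDiscreteValuationRing.addVal R (∏ i ∈ s, a i) =
      ∑ i ∈ s, IsDiscreteValuationRing.addVal R (a i) := by
  classical
  induction s using Finset.induction_on with
  | empty => simp
  | insert i s hi ih => rw [Finset.prod_insert hi, Finset.sum_insert hi,
      IsDiscreteValuationRing.addVal_mul, ih]

lemma wv_prod {ι : Type*} (s : Finset ι) (a : ι → R) (L : ℕ)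
    (h : ∏ i ∈ s, a i ∉ maximalIdeal R ^ L) :
    wv L (∏ i ∈ s, a i) = ∑ i ∈ s, wv L (a i) := by
  have h1 : ∀ i ∈ s, a i ∉ maximalIdeal R ^ L := fun i hi hm =>
    h (Ideal.mem_of_dvd _ (Finset.dvd_prod_of_mem a hi) hm)
  have : ((wv L (∏ i ∈ s, a i) : ℕ) : ℕ∞) = ((∑ i ∈ s, wv L (a i) : ℕ) : ℕ∞) := by
    rw [wv_cast _ _ h, addVal_prod, Nat.cast_sum]
    exact Finset.sum_congr rfl (fun i hi => (wv_cast _ _ (h1 i hi)).symm)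
  exact_mod_cast this

set_option maxHeartbeats 1000000 in
lemma count_main [Finite (R ⧸ maximalIdeal R)] (n : ℕ) (hn0 : 0 < n) (ζ : R)
    (hζ : IsPrimitiveRoot ζ n) (q : ℕ) (hq : q = Nat.card (R ⧸ maximalIdeal R)) (L : ℕ) :
    |∑ k ∈ Finset.Icc 1 L, (rootCount R n k : ℝ) / q ^ k - n * ∑ k ∈ Finset.Icc 1 L, 1 / (q:ℝ) ^ k|
      ≤ n * L * rootCount R n L / q ^ L := by
  classical
  have := finq R
  let _ : ∀ k, Fintype (R ⧸ maximalIdeal R ^ k) := fun k => Fintype.ofFinite _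
  have hcard : ∀ k, Fintype.card (R ⧸ maximalIdeal R ^ k) = q ^ k := fun k => by
    rw [← Nat.card_eq_fintype_card, cqp, hq]
  have hq0 : 0 < q := by
    rw [hq]; have : Nonempty (R ⧸ maximalIdeal R) := ⟨0⟩; exact Nat.card_pos
  have hqR : (0:ℝ) < q := by exact_mod_cast hq0
  let o : R ⧸ maximalIdeal R ^ L → R := fun y => Quotient.out y
  have ho : ∀ y, Ideal.Quotient.mk (maximalIdeal R ^ L) (o y) = y := fun y => Quotient.out_eq y
  have hrc : ∀ k, rootCount R n k =
      (Finset.univ.filter (fun x : R ⧸ maximalIdeal R ^ k => x ^ n = 1)).card := fun k => by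
    rw [rootCount, Nat.card_eq_fintype_card, Fintype.card_subtype]
  -- fibre counting
  have fib : ∀ k ∈ Finset.Icc 1 L, ∀ P : R ⧸ maximalIdeal R ^ k → Prop,
      ((Finset.univ.filter (fun y => P (Ideal.Quotient.mk (maximalIdeal R ^ k) (o y)))).card : ℝ) / q ^ L =
        ((Finset.univ.filter P).card : ℝ) / q ^ k := by
    intro k hk P
    have hkL := (Finset.mem_Icc.mp hk).2
    have := card_fib (Ideal.Quotient.factorPow (maximalIdeal R) hkL)
      (Ideal.Quotient.factor_surjective _) P
    rw [hcard, hcard] at this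
    have e : ∀ y, Ideal.Quotient.factorPow (maximalIdeal R) hkL y =
        Ideal.Quotient.mk (maximalIdeal R ^ k) (o y) := by
      intro y
      conv_lhs => rw [← ho y]
      rfl
    simp_rw [e] at this
    rw [div_eq_div_iff (by positivity) (by positivity)]
    have h3 := congrArg (Nat.cast : ℕ → ℝ) this
    push_cast at h3
    rw [h3]; ring
  have s1 : ∑ k ∈ Finset.Icc 1 L, (rootCount R n k : ℝ) / q ^ k =
      (∑ y, (wv L (o y ^ n - 1) : ℝ)) / q ^ L := by
    unfold wv
    push_cast
    rw [Finset.sum_comm, Finset.sum_div]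
    refine Finset.sum_congr rfl (fun k hk => ?_)
    rw [hrc, ← fib k hk (fun x => x ^ n = 1), Finset.sum_boole]
    congr 3
    ext y
    simp only [Finset.mem_filter, Finset.mem_univ, true_and]
    rw [← map_pow, ← map_one (Ideal.Quotient.mk _), Ideal.Quotient.eq]
  have s2 : ∀ z : R, ∑ k ∈ Finset.Icc 1 L, 1 / (q:ℝ) ^ k =
      (∑ y, (wv L (o y - z) : ℝ)) / q ^ L := by
    intro z
    unfold wv
    push_cast
    rw [Finset.sum_comm, Finset.sum_div]
    refine Finset.sum_congr rfl (fun k hk => ?_)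
    have := fib k hk (fun x => x = Ideal.Quotient.mk _ z)
    have h1 : (Finset.univ.filter (fun x => x = Ideal.Quotient.mk (maximalIdeal R ^ k) z)).card = 1 :=
      Finset.card_eq_one.mpr ⟨Ideal.Quotient.mk (maximalIdeal R ^ k) z, by ext x; simp⟩
    rw [h1, Nat.cast_one] at this
    rw [← this, Finset.sum_boole]
    congr 3
    ext y
    simp only [Finset.mem_filter, Finset.mem_univ, true_and]
    rw [Ideal.Quotient.eq]
  have s3 : n * ∑ k ∈ Finset.Icc 1 L, 1 / (q:ℝ) ^ k =
      (∑ y, ∑ z ∈ Polynomial.nthRootsFinset n (1:R), (wv L (o y - z) : ℝ)) / q ^ L := by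
    rw [Finset.sum_comm, Finset.sum_div, Finset.sum_congr rfl (fun z _ => (s2 z).symm)]
    simp [hζ.card_nthRootsFinset]
  rw [s1, s3, ← sub_div, abs_div, abs_of_pos (show (0:ℝ) < q ^ L by positivity)]
  apply div_le_div_of_nonneg_right _ (by positivity)
  rw [← Finset.sum_sub_distrib]
  refine (Finset.abs_sum_le_sum_abs _ _).trans ?_
  have bd : ∀ y, |(wv L (o y ^ n - 1) : ℝ) -
      ∑ z ∈ Polynomial.nthRootsFinset n (1:R), (wv L (o y - z) : ℝ)| ≤
      if y ^ n = 1 then (n * L : ℝ) else 0 := by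
    intro y
    have hprod : o y ^ n - 1 = ∏ z ∈ Polynomial.nthRootsFinset n (1:R), (o y - z) := by
      have := hζ.pow_sub_pow_eq_prod_sub_mul (o y) 1 hn0
      simpa using this
    have hmem : o y ^ n - 1 ∈ maximalIdeal R ^ L ↔ y ^ n = 1 := by
      rw [← Ideal.Quotient.eq, map_pow, ho, map_one]
    split_ifs with h
    · have b1 : (wv L (o y ^ n - 1) : ℝ) ≤ L := Nat.cast_le.mpr (wv_le L (o y ^ n - 1))
      have b2 : ∑ z ∈ Polynomial.nthRootsFinset n (1:R), (wv L (o y - z) : ℝ) ≤ n * L := by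
        calc _ ≤ ∑ z ∈ Polynomial.nthRootsFinset n (1:R), (L:ℝ) :=
              Finset.sum_le_sum (fun z _ => Nat.cast_le.mpr (wv_le L (o y - z)))
          _ = _ := by simp [hζ.card_nthRootsFinset]
      have b3 : 0 ≤ ∑ z ∈ Polynomial.nthRootsFinset n (1:R), (wv L (o y - z) : ℝ) := by positivity
      have b4 : (0:ℝ) ≤ (wv L (o y ^ n - 1) : ℝ) := by positivity
      have b5 : (L:ℝ) ≤ n * L := by
        have : (1:ℝ) ≤ n := by exact_mod_cast hn0
        nlinarith [show (0:ℝ) ≤ L by positivity]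
      rw [abs_le]; constructor <;> linarith
    · rw [← hmem, hprod] at h
      rw [hprod, wv_prod _ _ _ h]
      simp
  refine (Finset.sum_le_sum (fun y _ => bd y)).trans ?_
  rw [← Finset.sum_filter, Finset.sum_const, hrc, nsmul_eq_mul]
  apply le_of_eq; ring
end

section chars
variable {R : Type*} [CommRing R] [IsDomain R] [IsDiscreteValuationRing R]
variable {K : Type*} [Field K] [Algebra R K] [IsFractionRing R K]

lemma unitsDecomp (K : Type*) [Field K] [Algebra R K] [IsFractionRing R K] :
    ∃ φ : Rˣ × Multiplicative ℤ ≃* Kˣ,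
      ∀ u : Rˣ, φ (u, 1) = Units.map (algebraMap R K : R →* K) u := by
  obtain ⟨ϖ, hϖ⟩ := IsDiscreteValuationRing.exists_irreducible R
  have hinj := IsFractionRing.injective R K
  have h0 : algebraMap R K ϖ ≠ 0 := fun h => hϖ.ne_zero (hinj (by rw [h, map_zero]))
  let w : Kˣ := Units.mk0 _ h0
  let f : Rˣ × Multiplicative ℤ →* Kˣ :=
    (Units.map (algebraMap R K : R →* K)).coprod (zpowersHom Kˣ w)
  have hf : ∀ u m, f (u, m) = Units.map (algebraMap R K : R →* K) u * w ^ (Multiplicative.toAdd m) := by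
    intro u m; simp [f, zpowersHom_apply]
  have key : ∀ (u : Rˣ) (j : ℕ), algebraMap R K u = algebraMap R K ϖ ^ j → j = 0 := by
    intro u j h
    rw [← map_pow] at h
    have h2 := hinj h
    by_contra hj
    exact hϖ.not_isUnit ((isUnit_pow_iff hj).mp (h2 ▸ u.isUnit))
  have fi : Function.Injective f := by
    rw [injective_iff_map_eq_one]
    rintro ⟨u, m⟩ h
    rw [hf] at h
    have hm : Multiplicative.toAdd m = 0 := by
      rcases Int.eq_nat_or_neg (Multiplicative.toAdd m) with ⟨j, hj | hj⟩
      · rw [hj] at h ⊢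
        have := key u⁻¹ j (by
          have h' := eq_inv_of_mul_eq_one_right h
          have := congrArg (Units.val) h'
          rw [← map_inv] at this
          simpa [w] using this.symm)
        simp [this]
      · rw [hj] at h ⊢
        have := key u j (by
          have h' := eq_inv_of_mul_eq_one_left h
          have := congrArg (Units.val) h'
          simpa [w] using this)
        simp [this]
    rw [hm] at h
    have hm' : m = 1 := hm
    subst hm'
    have h3 : Units.map (algebraMap R K : R →* K) u = 1 := by simpa using h
    have h4 : algebraMap R K u = algebraMap R K 1 := by
      have := congrArg Units.val h3
      simpa using this
    ext
    · simpa using hinj h4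
    · simp
  have fs : Function.Surjective f := by
    intro x
    obtain ⟨m, u, hx⟩ := IsDiscreteValuationRing.exists_units_eq_smul_zpow_of_irreducible hϖ x.ne_zero
    refine ⟨(u, Multiplicative.ofAdd m), ?_⟩
    rw [hf]
    ext
    rw [hx, Units.smul_def, Algebra.smul_def]
    simp [w]
  refine ⟨MulEquiv.ofBijective f ⟨fi, fs⟩, fun u => ?_⟩
  change f (u, 1) = _
  rw [hf]
  simp

/-- characters of order dividing `n` trivial on `1 + m ^ k` -/
def charSet (R : Type*) [CommRing R] [IsLocalRing R] (K : Type*) [Field K] [Algebra R K]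
    (n k : ℕ) : Set (Kˣ →* ℂˣ) :=
  {η | η ^ n = 1 ∧ ∀ u : Rˣ, (u : R) - 1 ∈ maximalIdeal R ^ k →
    η (Units.map (algebraMap R K : R →* K) u) = 1}

lemma card_dual_torsion (A : Type*) [CommGroup A] [Finite A] (n : ℕ) :
    Nat.card {χ : A →* ℂˣ // χ ^ n = 1} = Nat.card {x : A // x ^ n = 1} := by
  obtain ⟨e⟩ := CommGroup.monoidHom_mulEquiv_of_hasEnoughRootsOfUnity A ℂ
  refine Nat.card_congr (e.toEquiv.subtypeEquiv fun χ => ?_)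
  simp only [MulEquiv.toEquiv_eq_coe, EquivLike.coe_coe]
  rw [← map_pow, map_eq_one_iff e e.injective]

lemma card_units_torsion (A : Type*) [CommRing A] (n : ℕ) (hn : 0 < n) :
    Nat.card {x : Aˣ // x ^ n = 1} = Nat.card {x : A // x ^ n = 1} := by
  refine Nat.card_congr (Equiv.ofBijective (fun x => ⟨x.1, by
    rw [← Units.val_pow_eq_pow_val, x.2, Units.val_one]⟩) ⟨?_, ?_⟩)
  · intro x y h
    have : (x.1 : A) = y.1 := congrArg Subtype.val h
    exact Subtype.ext (Units.ext this)
  · rintro ⟨y, hy⟩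
    exact ⟨⟨Units.ofPowEqOne y n hy hn.ne', Units.ext (by simp)⟩, rfl⟩

lemma charSet_card [Finite (R ⧸ maximalIdeal R)] (n k : ℕ) (hn0 : 0 < n) (hk : 1 ≤ k) :
    (charSet R K n k).Finite ∧ (charSet R K n k).ncard = n * rootCount R n k := by
  have := finq R
  obtain ⟨φ, hφ⟩ := unitsDecomp (R := R) K
  let A := R ⧸ maximalIdeal R ^ k
  have : NeZero n := ⟨hn0.ne'⟩
  have hnt : Nontrivial A := Ideal.Quotient.nontrivial_iff.mpr (fun h => by
    have h2 : maximalIdeal R ^ k ≤ maximalIdeal R := Ideal.pow_le_self (by omega)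
    rw [h] at h2
    exact Ideal.IsPrime.ne_top' (top_le_iff.mp h2))
  let π : Rˣ →* Aˣ := Units.map (Ideal.Quotient.mk (maximalIdeal R ^ k) : R →* A)
  have hπ : Function.Surjective π :=
    IsLocalRing.surjective_units_map_of_local_ringHom (Ideal.Quotient.mk (maximalIdeal R ^ k))
      Ideal.Quotient.mk_surjective (IsLocalHom.of_surjective _ Ideal.Quotient.mk_surjective)
  have hker : ∀ u : Rˣ, π u = 1 ↔ (u : R) - 1 ∈ maximalIdeal R ^ k := by
    intro u
    rw [← Ideal.Quotient.eq, Units.ext_iff]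
    simp [π]
  let D := {χ : Aˣ →* ℂˣ // χ ^ n = 1} × rootsOfUnity n ℂ
  let Ψ : D → (Kˣ →* ℂˣ) := fun d =>
    ((d.1.1.comp π).coprod (zpowersHom ℂˣ d.2.1)).comp φ.symm.toMonoidHom
  have hΨ : ∀ d u m, Ψ d (φ (u, m)) = d.1.1 (π u) * d.2.1 ^ (Multiplicative.toAdd m) := by
    intro d u m
    simp [Ψ, zpowersHom_apply]
  have hinj : Function.Injective Ψ := by
    rintro ⟨⟨χ, h⟩, ⟨ω, h'⟩⟩ ⟨⟨χ', g⟩, ⟨ω', g'⟩⟩ he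
    have e1 : χ = χ' := by
      refine MonoidHom.ext fun a => ?_
      obtain ⟨u, rfl⟩ := hπ a
      have := congrArg (fun η => η (φ (u, 1))) he
      simp only [hΨ] at this
      simpa using this
    have e2 : ω = ω' := by
      have := congrArg (fun η => η (φ (1, Multiplicative.ofAdd 1))) he
      simp only [hΨ] at this
      simpa using this
    subst e1; subst e2; rfl
  have hrange : charSet R K n k = Set.range Ψ := by
    ext η
    constructor
    · rintro ⟨h1, h2⟩
      let χ := (π.liftOfSurjective hπ) ⟨η.comp (Units.map (algebraMap R K : R →* K)), by
        intro u hu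
        rw [MonoidHom.mem_ker] at hu ⊢
        exact h2 u ((hker u).mp hu)⟩
      have hχ : ∀ u, χ (π u) = η (Units.map (algebraMap R K : R →* K) u) := fun u =>
        MonoidHom.liftOfRightInverse_comp_apply _ _ _ _ u
      refine ⟨⟨⟨χ, ?_⟩, ⟨η (φ (1, Multiplicative.ofAdd 1)), ?_⟩⟩, ?_⟩
      · ext a
        obtain ⟨u, rfl⟩ := hπ a
        rw [MonoidHom.pow_apply, hχ, ← MonoidHom.pow_apply, h1]
        rfl
      · rw [mem_rootsOfUnity, ← MonoidHom.pow_apply, h1]; rfl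
      · refine MonoidHom.ext fun x => ?_
        obtain ⟨⟨u, m⟩, rfl⟩ := φ.surjective x
        rw [hΨ]
        dsimp only
        rw [hχ, ← hφ, ← map_zpow, ← map_zpow, ← map_mul, ← map_mul]
        congr 2
        ext
        · simp
        · simp [← ofAdd_zsmul]
    · rintro ⟨d, rfl⟩
      refine ⟨?_, fun u hu => ?_⟩
      · refine MonoidHom.ext fun x => ?_
        obtain ⟨⟨u, m⟩, rfl⟩ := φ.surjective x
        rw [MonoidHom.pow_apply, hΨ, mul_pow, ← MonoidHom.pow_apply, d.1.2, ← zpow_natCast,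
          zpow_comm, zpow_natCast, (mem_rootsOfUnity _ _).mp d.2.2]
        simp
      · rw [← hφ, hΨ, (hker u).mpr hu]
        simp
  have : Finite A := inferInstance
  have hc1 : Nat.card {χ : Aˣ →* ℂˣ // χ ^ n = 1} = rootCount R n k := by
    rw [card_dual_torsion, card_units_torsion _ _ hn0, rootCount]
  have hfin : Finite {χ : Aˣ →* ℂˣ // χ ^ n = 1} := by
    apply Nat.finite_of_card_ne_zero
    rw [card_dual_torsion]
    have : Nonempty {x : Aˣ // x ^ n = 1} := ⟨⟨1, one_pow _⟩⟩
    exact Nat.card_pos.ne'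
  rw [hrange]
  refine ⟨Set.finite_range _, ?_⟩
  rw [← Nat.card_coe_set_eq, Nat.card_range_of_injective hinj, Nat.card_prod, hc1,
    Complex.card_rootsOfUnity, mul_comm]
end chars

section hensel

lemma nth_root_of_complete {S : Type*} [CommRing S] (p : S)
    (hcomp : ∀ t : ℕ → S, (∀ k, p ^ k ∣ t (k + 1) - t k) → ∃ s, ∀ k, p ^ k ∣ s - t k)
    (hsep : ∀ x : S, (∀ k, p ^ k ∣ x) → x = 0) (n : ℕ) (z : S) :
    ∃ y : S, y ^ n = 1 + n ^ 2 * p * z := by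
  obtain ⟨G, hG⟩ := Polynomial.powAddExpansion (1 : Polynomial S)
    (Polynomial.C (n * p) * Polynomial.X) n
  let H : Polynomial S := Polynomial.X ^ 2 * G
  have hH : ∀ t, (1 + n * p * t) ^ n = 1 + n ^ 2 * p * (t + p * H.eval t) := by
    intro t
    have := congrArg (Polynomial.eval t) hG
    simp only [Polynomial.eval_pow, Polynomial.eval_add, Polynomial.eval_one, Polynomial.eval_mul,
      Polynomial.eval_C, Polynomial.eval_X, one_pow, Polynomial.eval_natCast] at this
    rw [this]
    simp only [H, Polynomial.eval_mul, Polynomial.eval_pow, Polynomial.eval_X]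
    ring
  let t : ℕ → S := fun k => Nat.rec z (fun _ x => z - p * H.eval x) k
  have ht : ∀ k, t (k + 1) = z - p * H.eval (t k) := fun k => rfl
  have hc : ∀ k, p ^ k ∣ t (k + 1) - t k := by
    intro k
    induction k with
    | zero => simp
    | succ k ih =>
      have e : t (k + 1 + 1) - t (k + 1) = p * (H.eval (t k) - H.eval (t (k + 1))) := by
        rw [ht (k + 1), ht k]; ring
      rw [e, pow_succ']
      refine mul_dvd_mul_left _ ?_
      have := (ih.trans (Polynomial.sub_dvd_eval_sub (t (k + 1)) (t k) H))
      rw [← neg_sub]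
      exact (dvd_neg.mpr this)
  obtain ⟨s, hs⟩ := hcomp t hc
  have hfix : s + p * H.eval s - z = 0 := by
    apply hsep
    intro k
    have e : s + p * H.eval s - z = (s - t k) - (t (k + 1) - t k) + p * (H.eval s - H.eval (t k)) := by
      rw [ht k]; ring
    rw [e]
    refine dvd_add (dvd_sub (hs k) (hc k)) (Dvd.dvd.mul_left ?_ _)
    exact (hs k).trans (Polynomial.sub_dvd_eval_sub _ _ H)
  refine ⟨1 + n * p * s, ?_⟩
  rw [hH, sub_eq_zero.mp hfix]

lemma padic_prec (p : ℕ) [Fact p.Prime] (t : ℕ → ℤ_[p])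
    (h : ∀ k, (p : ℤ_[p]) ^ k ∣ t (k + 1) - t k) : ∃ s, ∀ k, (p : ℤ_[p]) ^ k ∣ s - t k := by
  have hI : IsPrecomplete (maximalIdeal ℤ_[p]) ℤ_[p] := inferInstance
  have hmem : ∀ (k : ℕ) (x y : ℤ_[p]), x ≡ y [SMOD (maximalIdeal ℤ_[p] ^ k • ⊤ : Submodule ℤ_[p] ℤ_[p])] ↔
      (p : ℤ_[p]) ^ k ∣ x - y := by
    intro k x y
    rw [SModEq.sub_mem, smul_eq_mul, Ideal.mul_top, PadicInt.maximalIdeal_eq_span_p,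
      Ideal.span_singleton_pow, Ideal.mem_span_singleton]
  obtain ⟨s, hs⟩ := hI.prec (f := t) (by
    intro m n hmn
    rw [hmem]
    induction n, hmn using Nat.le_induction with
    | base => simp
    | succ n hmn ih =>
      have : t m - t (n + 1) = (t m - t n) - (t (n + 1) - t n) := by ring
      rw [this]
      exact dvd_sub ih ((pow_dvd_pow _ hmn).trans (h n)))
  refine ⟨s, fun k => ?_⟩
  rw [← hmem]
  exact (hs k).symm

lemma free_prec (p : ℕ) [Fact p.Prime] (S : Type*) [CommRing S] [Algebra ℤ_[p] S]
    [Module.Free ℤ_[p] S] [Module.Finite ℤ_[p] S] (t : ℕ → S)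
    (h : ∀ k, (p : S) ^ k ∣ t (k + 1) - t k) : ∃ s, ∀ k, (p : S) ^ k ∣ s - t k := by
  let b := Module.Free.chooseBasis ℤ_[p] S
  have hd : ∀ (k : ℕ) (x : S), (p : S) ^ k ∣ x ↔ ∀ i, (p : ℤ_[p]) ^ k ∣ b.repr x i := by
    intro k x
    have hp : ∀ c : S, (p : S) ^ k * c = ((p : ℤ_[p]) ^ k) • c := by
      intro c; rw [Algebra.smul_def]; simp
    constructor
    · rintro ⟨c, rfl⟩ i
      rw [hp, map_smul]
      exact ⟨b.repr c i, by simp⟩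
    · intro hx
      choose c hc using hx
      refine ⟨∑ i, c i • b i, ?_⟩
      rw [hp, Finset.smul_sum, ← b.sum_repr x]
      refine Finset.sum_congr rfl fun i _ => ?_
      rw [hc i, smul_smul]
  choose s hs using fun i => padic_prec p (fun k => b.repr (t k) i) (fun k => by
    have := (hd _ _).mp (h k) i
    simpa using this)
  refine ⟨∑ i, s i • b i, fun k => (hd _ _).mpr fun i => ?_⟩
  have : b.repr (∑ i, s i • b i) i = s i := by
    rw [b.repr_sum_self]
  rw [map_sub, Finsupp.sub_apply, this]
  exact hs i k
end hensel

section final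

lemma geom_ind (q : ℝ) (hq : 0 < q) (e L : ℕ) (he : 1 ≤ e) (hL : e ≤ L) :
    (q ^ e)⁻¹ = (1 - 1 / q) * ∑ k ∈ Finset.Icc 1 L, (if e ≤ k then 1 / q ^ k else 0) +
      1 / q ^ (L + 1) := by
  induction L, hL using Nat.le_induction with
  | base =>
    rw [Finset.sum_eq_single e]
    · simp only [le_refl, if_true]; field_simp; ring
    · intro b hb hne
      have := Finset.mem_Icc.mp hb
      rw [if_neg (by omega)]
    · intro h; exact absurd (Finset.mem_Icc.mpr ⟨he, le_refl _⟩) h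
  | succ L hL ih =>
    rw [Finset.sum_Icc_succ_top (by omega), if_pos (by omega), ih]
    field_simp
    ring

lemma geom_Icc (q : ℝ) (hq : 0 < q) (L : ℕ) :
    (1 - 1 / q) * ∑ k ∈ Finset.Icc 1 L, 1 / q ^ k = 1 / q - 1 / q ^ (L + 1) := by
  induction L with
  | zero => simp
  | succ L ih =>
    rw [Finset.sum_Icc_succ_top (by omega), mul_add, ih]
    field_simp
    ring

lemma limit_arg (q : ℝ) (hq : 1 < q) (n : ℕ) (M : ℕ → ℝ) (C T : ℝ) (N : ℕ)
    (hC : ∀ L, N ≤ L → M L = C)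
    (h1 : ∀ L, |∑ k ∈ Finset.Icc 1 L, M k / q ^ k - n * ∑ k ∈ Finset.Icc 1 L, 1 / q ^ k|
      ≤ n * L * M L / q ^ L)
    (h2 : ∀ L, N ≤ L → T = (1 - 1 / q) * ∑ k ∈ Finset.Icc 1 L, M k / q ^ k + M L / q ^ (L + 1)) :
    T = n * (1 / q) := by
  have hq0 : 0 < q := by linarith
  have hb : ∀ L, N ≤ L → |T - n * (1 / q)| ≤ (n * C) * (L / q ^ L) + (|C - n| / q) * (1 / q ^ L) := by
    intro L hL
    have e : T - n * (1 / q) = (1 - 1 / q) * (∑ k ∈ Finset.Icc 1 L, M k / q ^ k -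
        n * ∑ k ∈ Finset.Icc 1 L, 1 / q ^ k) + (C - n) / q ^ (L + 1) := by
      have := geom_Icc q hq0 L
      rw [h2 L hL, hC L hL, mul_sub, mul_left_comm, this]
      ring
    rw [e]
    refine (abs_add_le _ _).trans ?_
    have f1 : |1 - 1 / q| ≤ 1 := by
      have : 1 / q < 1 := by rw [div_lt_one hq0]; exact hq
      have : 0 < 1 / q := by positivity
      rw [abs_le]; constructor <;> linarith
    rw [abs_mul, abs_div, abs_of_pos (show 0 < q ^ (L + 1) by positivity)]
    have h1' := h1 L
    rw [hC L hL] at h1'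
    have f2 := mul_le_mul f1 h1' (abs_nonneg _) zero_le_one
    have e3 : |C - n| / q ^ (L + 1) = (|C - n| / q) * (1 / q ^ L) := by
      rw [pow_succ]; field_simp
    rw [e3]
    refine add_le_add_left (f2.trans (le_of_eq ?_)) _
    ring
  have hlim : Filter.Tendsto (fun L : ℕ => (n * C) * (L / q ^ L) + (|C - n| / q) * (1 / q ^ L))
      Filter.atTop (nhds ((n * C) * 0 + (|C - n| / q) * 0)) := by
    refine Filter.Tendsto.add (Filter.Tendsto.const_mul _ ?_) (Filter.Tendsto.const_mul _ ?_)
    · have := tendsto_pow_const_div_const_pow_of_one_lt 1 hq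
      simpa using this
    · have := tendsto_pow_const_div_const_pow_of_one_lt 0 hq
      simpa using this
  have hle := ge_of_tendsto hlim (Filter.eventually_atTop.mpr ⟨N, hb⟩)
  have h0 : |T - n * (1 / q)| = 0 := le_antisymm (by simpa using hle) (abs_nonneg _)
  exact sub_eq_zero.mp (abs_eq_zero.mp h0)

lemma pow_p_mem {R : Type*} [CommRing R] [IsLocalRing R] (p : ℕ)
    (hpm : (p : R) ∈ maximalIdeal R) (u : R) (hu : u - 1 ∈ maximalIdeal R) (j : ℕ) :
    u ^ p ^ j - 1 ∈ maximalIdeal R ^ (j + 1) := by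
  induction j with
  | zero => simpa using hu
  | succ j ih =>
    set v := u ^ p ^ j with hv
    have hvm : v - 1 ∈ maximalIdeal R := Ideal.pow_le_self (by omega) ih
    rw [pow_succ p, pow_mul, ← hv, ← mul_geom_sum, pow_succ (maximalIdeal R)]
    refine Ideal.mul_mem_mul ih ?_
    rw [← Ideal.Quotient.eq_zero_iff_mem] at hpm ⊢
    have hv1 : Ideal.Quotient.mk (maximalIdeal R) v = 1 := by
      rw [← map_one (Ideal.Quotient.mk (maximalIdeal R)), Ideal.Quotient.eq]; exact hvm
    simpa [map_sum, map_pow, hv1] using hpm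

theorem main_abs {R : Type*} [CommRing R] [IsDomain R] [IsDiscreteValuationRing R]
    {K : Type*} [Field K] [Algebra R K] [IsFractionRing R K] [Finite (R ⧸ maximalIdeal R)]
    (p : ℕ) (hp2 : Odd p) (hpm : (p : R) ∈ maximalIdeal R)
    (hens : ∀ n : ℕ, 0 < n → ∃ N : ℕ, 1 ≤ N ∧ ∀ u : Rˣ, (u : R) - 1 ∈ maximalIdeal R ^ N →
      ∃ y : Rˣ, y ^ n = u)
    (n : ℕ) (hn : Odd n) (ζ : R) (hζ : IsPrimitiveRoot ζ n)
    (q : ℕ) (hq : q = Nat.card (R ⧸ maximalIdeal R))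
    (θ : Kˣ →* ℂˣ) (hθ2 : ∀ x, θ x ^ 2 = 1)
    (hθ : ¬ ∀ u : Rˣ, θ (Units.map (algebraMap R K : R →* K) u) = 1)
    (cond : (Kˣ →* ℂˣ) → ℕ)
    (hcond : ∀ χ : Kˣ →* ℂˣ, (¬ ∀ u : Rˣ, χ (Units.map (algebraMap R K : R →* K) u) = 1) →
      cond χ = sInf {k : ℕ | 1 ≤ k ∧ ∀ u : Rˣ, (u : R) - 1 ∈ maximalIdeal R ^ k →
        χ (Units.map (algebraMap R K : R →* K) u) = 1}) :
    {η : Kˣ →* ℂˣ | η ^ n = 1}.Finite ∧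
    ∑ᶠ η ∈ {η : Kˣ →* ℂˣ | η ^ n = 1}, ((q : ℝ) ^ cond (θ * η))⁻¹ = (n : ℝ) ^ 2 * (q : ℝ)⁻¹ := by
  classical
  have hn0 : 0 < n := hn.pos
  set ι : Rˣ →* Kˣ := Units.map (algebraMap R K : R →* K) with hι
  have hq1 : 1 < q := by
    rw [hq]; exact Finite.one_lt_card
  have hqR : (1:ℝ) < q := by exact_mod_cast hq1
  -- θ trivial on 1 + m
  have hθ1 : ∀ u : Rˣ, (u : R) - 1 ∈ maximalIdeal R → θ (ι u) = 1 := by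
    intro u hu
    obtain ⟨N, hN, hy⟩ := hens 2 (by norm_num)
    obtain ⟨y, hy⟩ := hy (u ^ p ^ N) (by
      have := pow_p_mem p hpm u hu N
      rw [Units.val_pow_eq_pow_val]
      exact Ideal.pow_le_pow_right (by omega) this)
    have h1 : θ (ι u) ^ p ^ N = 1 := by
      rw [← map_pow, ← map_pow, ← hy, map_pow, map_pow, hθ2]
    obtain ⟨r, hr⟩ := hp2.pow (n := N)
    rw [hr, pow_succ, pow_mul, hθ2, one_pow, one_mul] at h1
    exact h1
  obtain ⟨N, hN1, hN⟩ := hens n hn0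
  set S : Set (Kˣ →* ℂˣ) := {η | η ^ n = 1} with hS
  have hSN : ∀ L, N ≤ L → charSet R K n L = S := by
    intro L hL
    ext η
    refine ⟨fun h => h.1, fun h => ⟨h, fun u hu => ?_⟩⟩
    obtain ⟨y, rfl⟩ := hN u (Ideal.pow_le_pow_right hL hu)
    rw [map_pow, map_pow, ← MonoidHom.pow_apply, h]
    rfl
  have hfin : S.Finite := by
    rw [← hSN N le_rfl]; exact (charSet_card n N hn0 hN1).1
  refine ⟨hfin, ?_⟩
  -- conductor
  have hnr : ∀ η ∈ S, ¬ ∀ u : Rˣ, (θ * η) (ι u) = 1 := by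
    intro η hη h
    apply hθ
    intro u
    have h1 := congrArg (· ^ n) (h u)
    simp only [MonoidHom.mul_apply, mul_pow, one_pow] at h1
    rw [← MonoidHom.pow_apply η, show η ^ n = 1 from hη, MonoidHom.one_apply, mul_one] at h1
    obtain ⟨r, hr⟩ := hn
    rw [hr, pow_succ, pow_mul, hθ2, one_pow, one_mul] at h1
    exact h1
  have htriv : ∀ η ∈ S, ∀ k, 1 ≤ k → ((∀ u : Rˣ, (u : R) - 1 ∈ maximalIdeal R ^ k →
        (θ * η) (ι u) = 1) ↔ η ∈ charSet R K n k) := by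
    intro η hη k hk
    have : ∀ u : Rˣ, (u : R) - 1 ∈ maximalIdeal R ^ k → (θ * η) (ι u) = η (ι u) := by
      intro u hu
      rw [MonoidHom.mul_apply, hθ1 u (Ideal.pow_le_self (by omega) hu), one_mul]
    constructor
    · intro h
      exact ⟨hη, fun u hu => by rw [← hι, ← this u hu]; exact h u hu⟩
    · intro h u hu
      rw [this u hu]; exact h.2 u hu
  have hmono : ∀ k l, k ≤ l → charSet R K n k ⊆ charSet R K n l := fun k l hkl η h =>
    ⟨h.1, fun u hu => h.2 u (Ideal.pow_le_pow_right hkl hu)⟩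
  have hcle : ∀ η ∈ S, 1 ≤ cond (θ * η) ∧
      ∀ k, 1 ≤ k → (cond (θ * η) ≤ k ↔ η ∈ charSet R K n k) := by
    intro η hη
    have hset : {k : ℕ | 1 ≤ k ∧ ∀ u : Rˣ, (u : R) - 1 ∈ maximalIdeal R ^ k →
        (θ * η) (ι u) = 1} = {k | 1 ≤ k ∧ η ∈ charSet R K n k} := by
      ext k
      simp only [Set.mem_ofPred_eq]
      exact and_congr_right fun hk => htriv η hη k hk
    rw [hcond _ (hnr η hη), hset]
    have hmem := Nat.sInf_mem (s := {k | 1 ≤ k ∧ η ∈ charSet R K n k})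
      ⟨N, hN1, by rw [hSN N le_rfl]; exact hη⟩
    refine ⟨hmem.1, fun k hk => ⟨fun h => hmono _ _ h hmem.2, fun h => Nat.sInf_le ⟨hk, h⟩⟩⟩
  set T := ∑ᶠ η ∈ S, ((q : ℝ) ^ cond (θ * η))⁻¹ with hT
  have hTs : T = ∑ η ∈ hfin.toFinset, ((q : ℝ) ^ cond (θ * η))⁻¹ :=
    finsum_mem_eq_finite_toFinset_sum _ hfin
  have hcount : ∀ k, 1 ≤ k →
      ((hfin.toFinset.filter (fun η => cond (θ * η) ≤ k)).card : ℝ) = n * rootCount R n k := by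
    intro k hk
    have := (charSet_card (R := R) (K := K) n k hn0 hk).2
    rw [← Nat.cast_mul, ← this, Set.ncard_eq_toFinset_card _ (charSet_card n k hn0 hk).1]
    congr 2
    ext η
    simp only [Finset.mem_filter, Set.Finite.mem_toFinset]
    constructor
    · rintro ⟨h1, h2⟩; exact ((hcle η h1).2 k hk).mp h2
    · intro h; exact ⟨h.1, ((hcle η h.1).2 k hk).mpr h⟩
  have hTL : ∀ L, N ≤ L → T = n * ((1 - 1 / q) * ∑ k ∈ Finset.Icc 1 L, (rootCount R n k : ℝ) / q ^ k +
      rootCount R n L / q ^ (L + 1)) := by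
    intro L hL
    have hall : ∀ η ∈ hfin.toFinset, 1 ≤ cond (θ * η) ∧ cond (θ * η) ≤ L := by
      intro η hη
      have hη' := hfin.mem_toFinset.mp hη
      exact ⟨(hcle η hη').1, ((hcle η hη').2 L (hN1.trans hL)).mpr (by rw [hSN L hL]; exact hη')⟩
    rw [hTs, Finset.sum_congr rfl (fun η hη => geom_ind q (by linarith) _ L (hall η hη).1 (hall η hη).2),
      Finset.sum_add_distrib, ← Finset.mul_sum, Finset.sum_comm]
    have hcL := hcount L (hN1.trans hL)
    rw [Finset.filter_true_of_mem (fun η hη => (hall η hη).2)] at hcL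
    rw [Finset.sum_const, nsmul_eq_mul, hcL]
    have : ∀ k ∈ Finset.Icc 1 L, ∑ η ∈ hfin.toFinset,
        (if cond (θ * η) ≤ k then 1 / (q:ℝ) ^ k else 0) = n * (rootCount R n k / q ^ k) := by
      intro k hk
      rw [← Finset.sum_filter, Finset.sum_const, nsmul_eq_mul, hcount k (Finset.mem_Icc.mp hk).1]
      ring
    rw [Finset.sum_congr rfl this, ← Finset.mul_sum]
    ring
  have hnR : (0:ℝ) < n := by exact_mod_cast hn0
  have hconst : ∀ L, N ≤ L → (rootCount R n L : ℝ) = S.ncard / n := by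
    intro L hL
    have := (charSet_card (R := R) (K := K) n L hn0 (hN1.trans hL)).2
    rw [hSN L hL] at this
    rw [this]; push_cast; field_simp
  have := limit_arg q hqR n (fun k => (rootCount R n k : ℝ)) (S.ncard / n) (T / n) N hconst
    (fun L => count_main n hn0 ζ hζ q hq L)
    (fun L hL => by rw [hTL L hL]; field_simp)
  have hTT : T = n * (T / n) := by field_simp
  rw [hTT, this]
  field_simp
end final

section padic
lemma finite_residue (p : ℕ) [Fact p.Prime] {S : Type*} [CommRing S] [Algebra ℤ_[p] S]
    [Module.Finite ℤ_[p] S] (I : Ideal S) (hpm : (p : S) ∈ I) : Finite (S ⧸ I) := by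
  obtain ⟨d, f, hf⟩ := Module.Finite.exists_fin' ℤ_[p] S
  let g : (Fin d → Fin p) → S ⧸ I := fun c =>
    Ideal.Quotient.mk I (f (fun i => ((c i : ℕ) : ℤ_[p])))
  apply Finite.of_surjective g
  intro y
  obtain ⟨x, rfl⟩ := Ideal.Quotient.mk_surjective y
  obtain ⟨a, rfl⟩ := hf x
  refine ⟨fun i => ⟨(a i).zmodRepr, (PadicInt.zmodRepr_spec (a i)).1⟩, ?_⟩
  simp only [g]
  rw [Ideal.Quotient.eq, ← map_sub]
  have h : ∀ i, ∃ b, ((a i).zmodRepr : ℤ_[p]) - a i = p * b := by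
    intro i
    have := (PadicInt.zmodRepr_spec (a i)).2
    rw [PadicInt.maximalIdeal_eq_span_p, Ideal.mem_span_singleton] at this
    obtain ⟨b, hb⟩ := this
    exact ⟨-b, by rw [mul_neg, ← hb]; ring⟩
  choose b hb using h
  have : (fun i => ((a i).zmodRepr : ℤ_[p])) - a = (p : ℤ_[p]) • b := by
    ext1 i
    simpa using hb i
  rw [this, map_smul, Algebra.smul_def, map_natCast]
  exact Ideal.mul_mem_right _ _ hpm

variable (p : ℕ) [Fact p.Prime] {S : Type*} [CommRing S] [IsDomain S] [IsDiscreteValuationRing S]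
  [Algebra ℤ_[p] S] [Module.Free ℤ_[p] S] [Module.Finite ℤ_[p] S] [CharZero S]

lemma hens_padic (hpm : (p : S) ∈ maximalIdeal S) (n : ℕ) (hn : 0 < n) :
    ∃ N : ℕ, 1 ≤ N ∧ ∀ u : Sˣ, (u : S) - 1 ∈ maximalIdeal S ^ N → ∃ y : Sˣ, y ^ n = u := by
  have hp0 : (p : S) ≠ 0 := by exact_mod_cast (Fact.out : p.Prime).ne_zero
  have hn0 : (n : S) ≠ 0 := by exact_mod_cast hn.ne'
  have hne : (n : S) ^ 2 * p ≠ 0 := mul_ne_zero (pow_ne_zero _ hn0) hp0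
  obtain ⟨v, hv⟩ := ENat.ne_top_iff_exists.mp
    (fun h => hne (IsDiscreteValuationRing.addVal_eq_top_iff.mp h))
  refine ⟨v + 1, by omega, fun u hu => ?_⟩
  rw [mem_pow_iff_addVal] at hu
  have hd : (n : S) ^ 2 * p ∣ (u : S) - 1 := by
    rw [← IsDiscreteValuationRing.addVal_le_iff_dvd, ← hv]
    refine le_trans ?_ hu
    exact_mod_cast Nat.le_succ v
  obtain ⟨z, hz⟩ := hd
  obtain ⟨y, hy⟩ := nth_root_of_complete (p : S) (free_prec p S) (by
    intro x hx
    have h1 : x ∈ (⨅ k : ℕ, (Ideal.span {(p : S)}) ^ k) := by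
      rw [Ideal.mem_iInf]
      intro k
      rw [Ideal.span_singleton_pow, Ideal.mem_span_singleton]
      exact hx k
    rw [Ideal.iInf_pow_eq_bot_of_isLocalRing] at h1
    · simpa using h1
    · rw [Ne, Ideal.span_singleton_eq_top]
      exact hpm) n z
  have hyu : y ^ n = u := by rw [hy, ← hz]; ring
  have hunit : IsUnit y := (isUnit_pow_iff hn.ne').mp (hyu ▸ u.isUnit)
  refine ⟨hunit.unit, Units.ext ?_⟩
  simpa using hyu
end padic

end helpers

lemma ring_facts (p : ℕ) [Fact p.Prime] (F : Type*) [Field F] [Algebra ℚ_[p] F]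
    [FiniteDimensional ℚ_[p] F] :
    ∃ alg : Algebra ℤ_[p] (ringOfInt p F), Module.Free ℤ_[p] (ringOfInt p F) ∧
      Module.Finite ℤ_[p] (ringOfInt p F) ∧ IsDedekindDomain (ringOfInt p F) ∧
      IsFractionRing (ringOfInt p F) F ∧ ¬ IsUnit (p : ringOfInt p F) ∧
      ∀ (n : ℕ) (x : F), 0 < n → x ^ n = 1 → x ∈ ringOfInt p F := by
  letI : Algebra ℤ_[p] F := ((algebraMap ℚ_[p] F).comp (algebraMap ℤ_[p] ℚ_[p])).toAlgebra
  haveI : IsScalarTower ℤ_[p] ℚ_[p] F := IsScalarTower.of_algebraMap_eq (fun _ => rfl)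
  haveI : CharZero F := charZero_of_injective_algebraMap (algebraMap ℚ_[p] F).injective
  haveI : Module.IsTorsionFree ℤ_[p] F := by
    have : Module.IsTorsionFree ℤ_[p] ℚ_[p] := inferInstance
    exact Module.IsTorsionFree.trans_faithfulSMul ℤ_[p] ℚ_[p] F
  let C := integralClosure ℤ_[p] F
  have h1 : Module.Free ℤ_[p] C := IsIntegralClosure.module_free ℤ_[p] ℚ_[p] F C
  have h2 : Module.Finite ℤ_[p] C := IsIntegralClosure.finite ℤ_[p] ℚ_[p] F C
  have h3 : IsDedekindDomain C := integralClosure.isDedekindDomain ℤ_[p] ℚ_[p] F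
  have h4 : IsFractionRing C F := integralClosure.isFractionRing_of_finite_extension ℚ_[p] F
  refine ⟨(inferInstance : Algebra ℤ_[p] C), h1, h2, h3, h4, ?_, ?_⟩
  · intro h
    obtain ⟨y, hy⟩ := h.exists_right_inv
    have hyF : (p : F) * (y : F) = 1 := by
      have := congrArg (Subtype.val) hy
      simpa using this
    have hyint : IsIntegral ℤ_[p] (y : F) := y.2
    have hp0 : (p : F) ≠ 0 := by exact_mod_cast (Fact.out : p.Prime).ne_zero
    have hye : (y : F) = algebraMap ℚ_[p] F ((p : ℚ_[p])⁻¹) := by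
      rw [map_inv₀, map_natCast]
      exact eq_inv_of_mul_eq_one_right hyF
    rw [hye, isIntegral_algebraMap_iff (algebraMap ℚ_[p] F).injective] at hyint
    obtain ⟨z, hz⟩ := IsIntegrallyClosed.isIntegral_iff.mp hyint
    have hz1 : (p : ℤ_[p]) * z = 1 := by
      apply IsFractionRing.injective ℤ_[p] ℚ_[p]
      rw [map_mul, hz, map_natCast, map_one, mul_inv_cancel₀]
      exact_mod_cast (Fact.out : p.Prime).ne_zero
    exact PadicInt.p_nonunit (p := p) (IsUnit.of_mul_eq_one _ hz1)
  · intro n x hn hx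
    change IsIntegral ℤ_[p] x
    exact IsIntegral.of_pow hn (hx ▸ isIntegral_one)

/-- Let `p` be an odd prime, `n` an odd positive integer divisible by `p`, and `F` a finite
extension of `ℚ_p` containing `n` distinct `n`-th roots of unity, with ring of integers `O`,
maximal ideal `𝔪` and residue field of cardinality `q`. For every ramified quadratic
character `θ` of `Fˣ`, the set of characters `η` of `Fˣ` with `ηⁿ = 1` is finite and
`Σ_{ηⁿ = 1} q^{-e(θη)} = n² q⁻¹`. -/
theorem stmt6 (p : ℕ) [Fact p.Prime] (hp : p ≠ 2)
    (n : ℕ) (hn : Odd n) (hn0 : 0 < n) (hpn : p ∣ n)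
    (F : Type*) [Field F] [Algebra ℚ_[p] F] [FiniteDimensional ℚ_[p] F]
    (hroots : ∃ ζ : F, IsPrimitiveRoot ζ n)
    (O : Subring F) (hO : O = ringOfInt p F)
    (𝔪 : Ideal O) (h𝔪 : ∀ x : O, x ∈ 𝔪 ↔ ¬IsUnit x)
    (q : ℕ) (hq : q = Nat.card (O ⧸ 𝔪))
    (θ : Fˣ →* ℂˣ) (hθ2 : ∀ x, θ x ^ 2 = 1) (hθram : ¬IsUnramifiedChar O θ) :
    {η : Fˣ →* ℂˣ | η ^ n = 1}.Finite ∧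
    ∑ᶠ η ∈ {η : Fˣ →* ℂˣ | η ^ n = 1},
        ((q : ℝ) ^ conductorChar O 𝔪 (θ * η))⁻¹ = (n : ℝ) ^ 2 * (q : ℝ)⁻¹ := by
  
  subst hO
  obtain ⟨alg, hfree, hfinite, hded, hfrac, hpu, hint⟩ := ring_facts p F
  have hcz : CharZero F := charZero_of_injective_algebraMap (algebraMap ℚ_[p] F).injective
  have hczO : CharZero (ringOfInt p F) :=
    ⟨fun a b h => by
      have := congrArg (Subtype.val) h
      simpa using this⟩
  have hloc : IsLocalRing (ringOfInt p F) := IsLocalRing.of_nonunits_add (by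
    intro a b ha hb
    exact (h𝔪 _).mp (𝔪.add_mem ((h𝔪 a).mpr ha) ((h𝔪 b).mpr hb)))
  have hm : 𝔪 = IsLocalRing.maximalIdeal (ringOfInt p F) := by
    ext x
    rw [h𝔪, IsLocalRing.mem_maximalIdeal, mem_nonunits_iff]
  subst hm
  have hpm : (p : ringOfInt p F) ∈ IsLocalRing.maximalIdeal (ringOfInt p F) := hpu
  have hp0 : (p : ringOfInt p F) ≠ 0 := by exact_mod_cast (Fact.out : p.Prime).ne_zero
  have hbot : IsLocalRing.maximalIdeal (ringOfInt p F) ≠ ⊥ := by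
    intro h
    rw [h] at hpm
    exact hp0 (by simpa using hpm)
  have hnf : ¬ IsField (ringOfInt p F) := fun h =>
    hbot (IsLocalRing.isField_iff_maximalIdeal_eq.mp h)
  have hdvr : IsDiscreteValuationRing (ringOfInt p F) :=
    ((IsDiscreteValuationRing.TFAE (ringOfInt p F) hnf).out 0 2).mpr hded
  have hres := finite_residue p (IsLocalRing.maximalIdeal (ringOfInt p F)) hpm
  obtain ⟨ζ, hζ⟩ := hroots
  have hζO : IsPrimitiveRoot (⟨ζ, hint n ζ hn0 hζ.pow_eq_one⟩ : ringOfInt p F) n :=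
    IsPrimitiveRoot.of_map_of_injective (f := (ringOfInt p F).subtype) hζ Subtype.val_injective
  have hunr : ∀ χ : Fˣ →* ℂˣ, IsUnramifiedChar (ringOfInt p F) χ ↔
      ∀ u : (ringOfInt p F)ˣ, χ (Units.map (algebraMap (ringOfInt p F) F : ringOfInt p F →* F) u) = 1 := by
    intro χ
    constructor
    · intro h u
      refine h _ (u : ringOfInt p F).2 ?_
      rw [← map_inv]
      exact ((u⁻¹ : (ringOfInt p F)ˣ) : ringOfInt p F).2
    · intro h u h1 h2
      have := h ⟨⟨u, h1⟩, ⟨_, h2⟩, Subtype.ext (by simp), Subtype.ext (by simp)⟩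
      rw [← this]
      congr 1
  have htr : ∀ (χ : Fˣ →* ℂˣ) (k : ℕ), 1 ≤ k →
      (TrivOnOneAdd (IsLocalRing.maximalIdeal (ringOfInt p F)) k χ ↔
      ∀ u : (ringOfInt p F)ˣ, (u : ringOfInt p F) - 1 ∈ IsLocalRing.maximalIdeal (ringOfInt p F) ^ k →
        χ (Units.map (algebraMap (ringOfInt p F) F : ringOfInt p F →* F) u) = 1) := by
    intro χ k hk
    constructor
    · intro h u hu
      exact h _ ⟨_, hu, rfl⟩
    · rintro h u ⟨m, hm, hmu⟩
      have hm1 : m ∈ IsLocalRing.maximalIdeal (ringOfInt p F) := Ideal.pow_le_self (by omega) hm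
      have hu1 : IsUnit (1 + m) := by
        by_contra hcon
        have hc : 1 + m ∈ IsLocalRing.maximalIdeal (ringOfInt p F) := hcon
        have := (IsLocalRing.maximalIdeal (ringOfInt p F)).sub_mem hc hm1
        rw [add_sub_cancel_right] at this
        exact (h𝔪 1).mp this isUnit_one
      have := h hu1.unit (by
        rw [IsUnit.unit_spec, add_sub_cancel_left]; exact hm)
      rw [← this]
      congr 1
      ext
      have e : ((1 + m : ringOfInt p F) : F) = u := by
        push_cast; rw [hmu]; ring
      exact e.symm
  refine main_abs p ((Fact.out : p.Prime).odd_of_ne_two hp) hpm (hens_padic p hpm) n hn _ hζO q hq θ hθ2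
    (fun h => hθram ((hunr θ).mpr h)) (conductorChar _ _) ?_
  intro χ hχ
  rw [conductorChar, if_neg (fun h => hχ ((hunr χ).mp h))]
  congr 1
  ext k
  exact and_congr_right fun hk => htr χ k hk
end

section
/- Let n be an odd positive integer and let F be a finite extension of ℚ_p containing n distinct n-th roots of unity. Then the set of ramified characters η of Fˣ with ηⁿ = 1 is finite, and Σ over all such η of q^{−e(η)} equals n(n−1) · q^{−1}. -/
open scoped ENNReal
open MeasureTheory IsLocalRing

section PartOne
variable (R : Type*) [CommRing R] [IsDomain R] [IsDiscreteValuationRing R]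

open scoped Classical in
noncomputable def valE (y : R) : ℝ≥0∞ :=
  ∑' k : ℕ, if y ∈ maximalIdeal R ^ (k + 1) then 1 else 0

noncomputable def torsCount (n k : ℕ) : ℕ :=
  Nat.card {x : (R ⧸ maximalIdeal R ^ k)ˣ // x ^ n = 1}

variable {R}

lemma valE_zero : valE R 0 = ⊤ := by
  simp [valE]

lemma valE_unit_mul_pow {ϖ : R} (hϖ : Irreducible ϖ) (u : Rˣ) (j : ℕ) :
    valE R (u * ϖ ^ j) = j := by
  classical
  have h : ∀ k : ℕ, ((u : R) * ϖ ^ j ∈ maximalIdeal R ^ (k + 1)) ↔ k ∈ Finset.range j := by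
    intro k
    rw [hϖ.maximalIdeal_eq, Ideal.span_singleton_pow, Ideal.mem_span_singleton,
      Units.dvd_mul_left, pow_dvd_pow_iff hϖ.ne_zero hϖ.not_isUnit, Finset.mem_range]
    omega
  unfold valE
  simp_rw [h]
  rw [tsum_eq_sum (s := Finset.range j)]
  · rw [Finset.sum_congr rfl (fun k hk => if_pos hk)]
    simp
  · intro b hb; simp [hb]

lemma valE_mul (a b : R) : valE R (a * b) = valE R a + valE R b := by
  obtain ⟨ϖ, hϖ⟩ := IsDiscreteValuationRing.exists_irreducible R
  by_cases ha : a = 0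
  · simp [ha, valE_zero]
  by_cases hb : b = 0
  · simp [hb, valE_zero]
  obtain ⟨i, u, rfl⟩ := IsDiscreteValuationRing.eq_unit_mul_pow_irreducible ha hϖ
  obtain ⟨j, v, rfl⟩ := IsDiscreteValuationRing.eq_unit_mul_pow_irreducible hb hϖ
  have : (u : R) * ϖ ^ i * (v * ϖ ^ j) = ((u * v : Rˣ) : R) * ϖ ^ (i + j) := by
    push_cast; ring
  rw [this, valE_unit_mul_pow hϖ, valE_unit_mul_pow hϖ, valE_unit_mul_pow hϖ]
  push_cast; rfl

lemma valE_one : valE R 1 = 0 := by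
  obtain ⟨ϖ, hϖ⟩ := IsDiscreteValuationRing.exists_irreducible R
  simpa using valE_unit_mul_pow hϖ 1 0

lemma valE_prod {ι : Type*} (s : Finset ι) (f : ι → R) :
    valE R (∏ i ∈ s, f i) = ∑ i ∈ s, valE R (f i) := by
  classical
  induction s using Finset.induction_on with
  | empty => simp [valE_one]
  | insert a s ha ih => rw [Finset.prod_insert ha, Finset.sum_insert ha, valE_mul, ih]

variable [TopologicalSpace R] [IsTopologicalRing R] [CompactSpace R] [T2Space R]
  [MeasurableSpace R] [BorelSpace R]

lemma measurableSet_maxPow (k : ℕ) : MeasurableSet ((maximalIdeal R ^ k : Ideal R) : Set R) :=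
  (isOpen_maximalIdeal_pow R k).measurableSet

lemma measurable_valE : Measurable (valE R) := by
  classical
  unfold valE
  refine Measurable.tsum fun k => ?_
  exact Measurable.ite (measurableSet_maxPow (k+1)) measurable_const measurable_const

variable (μ : Measure R) [μ.IsAddHaarMeasure]

lemma measure_preimage_mk (I : Ideal R) (hI : MeasurableSet (I : Set R)) [Finite (R ⧸ I)]
    (T : Set (R ⧸ I)) : μ (Ideal.Quotient.mk I ⁻¹' T) = (Nat.card T : ℝ≥0∞) * μ (I : Set R) := by
  classical
  have := Fintype.ofFinite (R ⧸ I)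
  have fib : ∀ a : R, Ideal.Quotient.mk I ⁻¹' {Ideal.Quotient.mk I a} = (fun x => x + (-a)) ⁻¹' (I : Set R) := by
    intro a; ext x
    simp [Ideal.Quotient.eq, sub_eq_add_neg]
  have hfib : ∀ t : R ⧸ I, MeasurableSet (Ideal.Quotient.mk I ⁻¹' {t}) ∧
      μ (Ideal.Quotient.mk I ⁻¹' {t}) = μ (I : Set R) := by
    intro t
    obtain ⟨a, rfl⟩ := Ideal.Quotient.mk_surjective t
    rw [fib]
    exact ⟨measurable_add_const _ hI, measure_preimage_add_right μ _ _⟩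
  have : Ideal.Quotient.mk I ⁻¹' T = ⋃ t ∈ T.toFinset, Ideal.Quotient.mk I ⁻¹' {t} := by
    ext x; simp
  rw [this, measure_biUnion_finset]
  · simp [hfib, Nat.card_eq_fintype_card]
  · intro a _ b _ hab
    exact Disjoint.preimage _ (by simpa using hab)
  · intro t _; exact (hfib t).1

lemma finite_quot_pow (k : ℕ) : Finite (R ⧸ maximalIdeal R ^ k) := 
  Ideal.finite_quotient_pow (IsNoetherian.noetherian _) _

lemma card_quot_pow (k : ℕ) :
    Nat.card (R ⧸ maximalIdeal R ^ k) = Nat.card (R ⧸ maximalIdeal R) ^ k := by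
  have := cardQuot_pow_of_prime (P := maximalIdeal R) (IsDiscreteValuationRing.not_a_field R) (i := k)
  simpa [Submodule.cardQuot_apply] using this

lemma one_lt_card : 1 < Nat.card (R ⧸ maximalIdeal R) := by
  have : Finite (R ⧸ maximalIdeal R) := inferInstance
  exact Finite.one_lt_card

lemma measure_maxPow (hμ : μ Set.univ = 1) (k : ℕ) :
    μ ((maximalIdeal R ^ k : Ideal R) : Set R) = ((Nat.card (R ⧸ maximalIdeal R) : ℝ≥0∞)⁻¹) ^ k := by
  have := finite_quot_pow (R := R) k
  have h := measure_preimage_mk μ (maximalIdeal R ^ k) (measurableSet_maxPow k) Set.univ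
  rw [Set.preimage_univ, hμ, Nat.card_congr (Equiv.Set.univ _), card_quot_pow] at h
  rw [← ENNReal.inv_pow]
  apply ENNReal.eq_inv_of_mul_eq_one_left
  rw [h, mul_comm]; push_cast; rfl

lemma measure_tors (hμ : μ Set.univ = 1) (n : ℕ) (hn : 0 < n) (k : ℕ) :
    μ {x : R | x ^ n - 1 ∈ maximalIdeal R ^ k} =
      torsCount R n k * ((Nat.card (R ⧸ maximalIdeal R) : ℝ≥0∞)⁻¹) ^ k := by
  have := finite_quot_pow (R := R) k
  have h := measure_preimage_mk μ (maximalIdeal R ^ k) (measurableSet_maxPow k) {x | x ^ n = 1}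
  rw [measure_maxPow μ hμ] at h
  convert h using 2
  · ext x
    simp only [Set.mem_ofPred_eq, Set.mem_preimage]
    rw [← map_pow, ← map_one (Ideal.Quotient.mk (maximalIdeal R ^ k)), Ideal.Quotient.eq]
  · congr 1
    unfold torsCount
    refine Nat.card_congr (Equiv.ofBijective
      (fun x => ⟨(x.1 : R ⧸ maximalIdeal R ^ k), by
        have := x.2; rw [Set.mem_ofPred_eq, ← Units.val_pow_eq_pow_val, this, Units.val_one]⟩) ⟨?_, ?_⟩)
    · intro x y hxy
      apply Subtype.ext; apply Units.ext
      simpa using hxy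
    · rintro ⟨x, hx⟩
      exact ⟨⟨Units.ofPowEqOne x n hx hn.ne', Units.pow_ofPowEqOne _ _⟩, rfl⟩

end PartOne

lemma key_sum {R : Type*} [CommRing R] [IsDomain R] [IsDiscreteValuationRing R]
    [TopologicalSpace R] [IsTopologicalRing R] [CompactSpace R] [T2Space R] (n : ℕ) (hn : 0 < n) (hroots : ∃ ζ : R, IsPrimitiveRoot ζ n) :
    ∑' k : ℕ, (torsCount R n (k + 1) : ℝ≥0∞) *
        ((Nat.card (R ⧸ maximalIdeal R) : ℝ≥0∞)⁻¹) ^ (k + 1) =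
      n * ∑' k : ℕ, ((Nat.card (R ⧸ maximalIdeal R) : ℝ≥0∞)⁻¹) ^ (k + 1) := by
  classical
  borelize R
  obtain ⟨ζ, hζ⟩ := hroots
  let μ : Measure R := Measure.addHaarMeasure ⊤
  have hμ : μ Set.univ = 1 := Measure.addHaarMeasure_self (K₀ := (⊤ : TopologicalSpace.PositiveCompacts R))
  have hint : ∀ f : R → R, Measurable f → ∫⁻ x, valE R (f x) ∂μ =
      ∑' k : ℕ, μ {x | f x ∈ maximalIdeal R ^ (k + 1)} := by
    intro f hf
    unfold valE
    rw [lintegral_tsum]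
    · refine tsum_congr fun k => ?_
      have hm : MeasurableSet {x | f x ∈ maximalIdeal R ^ (k + 1)} := hf (measurableSet_maxPow (k+1))
      rw [← lintegral_indicator_one hm]
      refine lintegral_congr fun x => ?_
      simp [Set.indicator_apply]
    · intro k
      exact (Measurable.ite (hf (measurableSet_maxPow (k+1))) measurable_const measurable_const).aemeasurable
  have h1 : ∫⁻ x, valE R (x ^ n - 1) ∂μ = ∑' k : ℕ, (torsCount R n (k + 1) : ℝ≥0∞) *
        ((Nat.card (R ⧸ maximalIdeal R) : ℝ≥0∞)⁻¹) ^ (k + 1) := by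
    rw [hint (fun x => x ^ n - 1) (by fun_prop : Continuous fun x : R => x ^ n - 1).measurable]
    exact tsum_congr fun k => measure_tors μ hμ n hn (k+1)
  have h0 : ∫⁻ x, valE R x ∂μ = ∑' k : ℕ, ((Nat.card (R ⧸ maximalIdeal R) : ℝ≥0∞)⁻¹) ^ (k + 1) := by
    rw [hint (fun x => x) measurable_id]
    exact tsum_congr fun k => measure_maxPow μ hμ (k+1)
  have h2 : ∫⁻ x, valE R (x ^ n - 1) ∂μ = n * ∫⁻ x, valE R x ∂μ := by
    have : ∀ x : R, valE R (x ^ n - 1) =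
        ∑ z ∈ Polynomial.nthRootsFinset n (1 : R), valE R (x + (- z)) := by
      intro x
      have := hζ.pow_sub_pow_eq_prod_sub_mul x 1 hn
      rw [one_pow] at this
      rw [this, valE_prod]
      simp [sub_eq_add_neg]
    simp_rw [this]
    rw [lintegral_finsetSum]
    · simp_rw [lintegral_add_right_eq_self (valE R)]
      simp [hζ.card_nthRootsFinset]
    · intro z _
      exact measurable_valE.comp (measurable_add_const _)
  rw [← h1, ← h0, h2]

open IsLocalRing

section PartTwo
variable {R : Type*} [CommRing R] [IsDomain R] [IsDiscreteValuationRing R]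
variable {F : Type*} [Field F] [Algebra R F] [IsFractionRing R F]

variable (R F) in
noncomputable def unitsEmb : Rˣ →* Fˣ := Units.map (algebraMap R F : R →* F)

variable (R F) in
def TrivLevel (k : ℕ) (η : Fˣ →* ℂˣ) : Prop :=
  ∀ u : Rˣ, (u : R) - 1 ∈ maximalIdeal R ^ k → η (unitsEmb R F u) = 1

noncomputable def splitHom (ϖ : Fˣ) : Rˣ × Multiplicative ℤ →* Fˣ :=
  (unitsEmb R F).coprod (zpowersHom Fˣ ϖ)

lemma splitHom_bijective {ϖ : R} (hϖ : Irreducible ϖ) (π : Fˣ) (hπ : (π : F) = algebraMap R F ϖ) :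
    Function.Bijective (splitHom (R := R) π) := by
  have hinj : Function.Injective (algebraMap R F) := IsFractionRing.injective R F
  have nat : ∀ (u : Rˣ) (j : ℕ), unitsEmb R F u * π ^ j = 1 → u = 1 ∧ j = 0 := by
    intro u j h
    have h' : algebraMap R F (u * ϖ ^ j) = algebraMap R F 1 := by
      have := congrArg (fun x : Fˣ => (x : F)) h
      simpa [unitsEmb, hπ] using this
    have h2 := hinj h'
    have hj : j = 0 := by
      by_contra hj
      apply hϖ.not_isUnit
      have : IsUnit (ϖ ^ j) := IsUnit.of_mul_eq_one (u : R) (by rw [mul_comm]; exact h2)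
      exact (isUnit_pow_iff hj).1 this
    subst hj
    refine ⟨Units.ext (by simpa using h2), rfl⟩
  constructor
  · rw [injective_iff_map_eq_one]
    rintro ⟨u, j⟩ h
    have h1 : unitsEmb R F u * π ^ (j.toAdd) = 1 := by simpa [splitHom] using h
    obtain ⟨m, hm | hm⟩ := Int.eq_nat_or_neg j.toAdd
    · rw [hm, zpow_natCast] at h1
      obtain ⟨rfl, rfl⟩ := nat _ _ h1
      ext <;> simp_all
    · rw [hm, zpow_neg, zpow_natCast] at h1
      have h2 : unitsEmb R F u⁻¹ * π ^ m = 1 := by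
        rw [map_inv, ← inv_inj, mul_inv, inv_inv, h1, inv_one]
      obtain ⟨h3, rfl⟩ := nat _ _ h2
      rw [inv_eq_one] at h3
      subst h3
      ext <;> simp_all
  · intro x
    obtain ⟨a, b, hb, hab⟩ := IsFractionRing.div_surjective (A := R) (x : F)
    have hb0 : b ≠ 0 := nonZeroDivisors.ne_zero hb
    have ha0 : a ≠ 0 := by
      rintro rfl
      apply x.ne_zero
      rw [← hab]; simp
    obtain ⟨i, u, rfl⟩ := IsDiscreteValuationRing.eq_unit_mul_pow_irreducible ha0 hϖ
    obtain ⟨j, v, rfl⟩ := IsDiscreteValuationRing.eq_unit_mul_pow_irreducible hb0 hϖ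
    refine ⟨(u * v⁻¹, Multiplicative.ofAdd ((i : ℤ) - j)), ?_⟩
    have e : splitHom (R := R) π (u * v⁻¹, Multiplicative.ofAdd ((i : ℤ) - j)) =
        (unitsEmb R F u * π ^ i) / (unitsEmb R F v * π ^ j) := by
      simp only [splitHom, MonoidHom.coprod_apply, map_mul, map_inv, zpowersHom_apply,
        toAdd_ofAdd, zpow_sub, zpow_natCast, div_eq_mul_inv, mul_inv]
      exact mul_mul_mul_comm _ _ _ _
    rw [e]
    apply Units.ext
    rw [← hab]
    simp [unitsEmb, hπ, Units.val_div_eq_div_val]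

variable (R) in
noncomputable def redHom (k : ℕ) : Rˣ →* (R ⧸ maximalIdeal R ^ k)ˣ :=
  Units.map (Ideal.Quotient.mk (maximalIdeal R ^ k) : R →* _)

lemma redHom_surjective (k : ℕ) : Function.Surjective (redHom R k) := by
  cases k with
  | zero =>
    have : Subsingleton (R ⧸ maximalIdeal R ^ 0) := by
      rw [pow_zero, Ideal.one_eq_top]
      exact Ideal.Quotient.subsingleton_iff.2 rfl
    intro x
    exact ⟨1, Units.ext (Subsingleton.elim _ _)⟩
  | succ k =>
    have : Nontrivial (R ⧸ maximalIdeal R ^ (k + 1)) := by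
      rw [Ideal.Quotient.nontrivial_iff]
      intro h
      have h2 : maximalIdeal R ^ (k + 1) ≤ maximalIdeal R := Ideal.pow_le_self (by omega)
      rw [h, top_le_iff] at h2
      exact Ideal.IsPrime.ne_top inferInstance h2
    exact surjective_units_map_of_local_ringHom (Ideal.Quotient.mk (maximalIdeal R ^ (k + 1)))
      Ideal.Quotient.mk_surjective (IsLocalHom.of_surjective _ Ideal.Quotient.mk_surjective)

lemma redHom_eq_one_iff (k : ℕ) (u : Rˣ) :
    redHom R k u = 1 ↔ (u : R) - 1 ∈ maximalIdeal R ^ k := by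
  rw [← Ideal.Quotient.eq, Units.ext_iff]
  rfl

lemma char_count (n : ℕ) (hn : 0 < n) (k : ℕ) [Finite (R ⧸ maximalIdeal R ^ k)] :
    Finite {η : Fˣ →* ℂˣ // η ^ n = 1 ∧ TrivLevel R F k η} ∧
    Nat.card {η : Fˣ →* ℂˣ // η ^ n = 1 ∧ TrivLevel R F k η} = n * torsCount R n k := by
  obtain ⟨ϖ, hϖ⟩ := IsDiscreteValuationRing.exists_irreducible R
  have hinj : Function.Injective (algebraMap R F) := IsFractionRing.injective R F
  let π : Fˣ := Units.mk0 (algebraMap R F ϖ) (by simpa using hϖ.ne_zero)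
  let Φ : Rˣ × Multiplicative ℤ ≃* Fˣ :=
    MulEquiv.ofBijective (splitHom (R := R) π) (splitHom_bijective hϖ π rfl)
  have hΦu : ∀ u : Rˣ, Φ (u, 1) = unitsEmb R F u := by
    intro u; simp [Φ, splitHom]
  have hΦπ : Φ (1, Multiplicative.ofAdd 1) = π := by
    simp [Φ, splitHom]
  have : NeZero n := ⟨hn.ne'⟩
  let G := (R ⧸ maximalIdeal R ^ k)ˣ
  let f0 : (G →* ℂˣ) → ℂˣ → (Fˣ →* ℂˣ) := fun χ z =>
    ((χ.comp (redHom R k)).coprod (zpowersHom ℂˣ z)).comp Φ.symm.toMonoidHom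
  have f0u : ∀ χ z u, f0 χ z (unitsEmb R F u) = χ (redHom R k u) := by
    intro χ z u
    simp [f0, ← hΦu]
  have f0π : ∀ χ z, f0 χ z π = z := by
    intro χ z
    simp [f0, ← hΦπ]
  have fext : ∀ η η' : Fˣ →* ℂˣ, (∀ u, η (unitsEmb R F u) = η' (unitsEmb R F u)) → η π = η' π →
      η = η' := by
    intro η η' h1 h2
    ext1 x
    obtain ⟨⟨u, j⟩, rfl⟩ := Φ.surjective x
    have : Φ (u, j) = unitsEmb R F u * π ^ j.toAdd := by simp [Φ, splitHom]
    rw [this, map_mul, map_mul, map_zpow, map_zpow, h1, h2]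
  let f : {χ : G →* ℂˣ // χ ^ n = 1} × rootsOfUnity n ℂ →
      {η : Fˣ →* ℂˣ // η ^ n = 1 ∧ TrivLevel R F k η} := fun x =>
    ⟨f0 x.1.1 x.2.1, by
      constructor
      · apply fext
        · intro u
          rw [MonoidHom.pow_apply, f0u, ← MonoidHom.pow_apply, x.1.2]; rfl
        · rw [MonoidHom.pow_apply, f0π]
          exact x.2.2
      · intro u hu
        rw [f0u, (redHom_eq_one_iff k u).2 hu, map_one]⟩
  have hf : Function.Bijective f := by
    constructor
    · rintro ⟨⟨χ, hχ⟩, ⟨z, hz⟩⟩ ⟨⟨χ', hχ'⟩, ⟨z', hz'⟩⟩ h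
      have h' : f0 χ z = f0 χ' z' := congrArg Subtype.val h
      have e1 : χ = χ' := by
        ext1 g
        obtain ⟨u, rfl⟩ := redHom_surjective k g
        rw [← f0u χ z, h', f0u]
      have e2 : z = z' := by rw [← f0π χ z, h', f0π]
      subst e1 e2; rfl
    · rintro ⟨η, hη, ht⟩
      have hker : (redHom R k).ker ≤ (η.comp (unitsEmb R F)).ker := by
        intro u hu
        exact ht u ((redHom_eq_one_iff k u).1 hu)
      let χ : G →* ℂˣ := (redHom R k).liftOfSurjective (redHom_surjective k)
        ⟨η.comp (unitsEmb R F), hker⟩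
      have hχ : ∀ u, χ (redHom R k u) = η (unitsEmb R F u) := fun u =>
        (redHom R k).liftOfRightInverse_comp_apply _
          (Function.rightInverse_surjInv (redHom_surjective k)) ⟨η.comp (unitsEmb R F), hker⟩ u
      refine ⟨(⟨χ, ?_⟩, ⟨η π, ?_⟩), ?_⟩
      · ext1 g
        obtain ⟨u, rfl⟩ := redHom_surjective k g
        rw [MonoidHom.pow_apply, hχ, ← MonoidHom.pow_apply, hη]; rfl
      · rw [mem_rootsOfUnity, ← MonoidHom.pow_apply, hη]; rfl
      · apply Subtype.ext
        apply fext
        · intro u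
          change f0 χ (η π) _ = _
          rw [f0u, hχ]
        · exact f0π _ _
  have hG : Finite G := inferInstance
  obtain ⟨E⟩ := CommGroup.monoidHom_mulEquiv_of_hasEnoughRootsOfUnity G ℂ
  have e3 : {χ : G →* ℂˣ // χ ^ n = 1} ≃ {x : G // x ^ n = 1} :=
    E.toEquiv.subtypeEquiv (fun χ => by
      change _ ↔ E χ ^ n = 1
      rw [← map_pow, EmbeddingLike.map_eq_one_iff])
  have : Finite {χ : G →* ℂˣ // χ ^ n = 1} := Finite.of_equiv _ e3.symm
  refine ⟨Finite.of_surjective f hf.2, ?_⟩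
  rw [← Nat.card_congr (Equiv.ofBijective f hf), Nat.card_prod, Nat.card_congr e3, mul_comm]
  congr 1
  exact Complex.card_rootsOfUnity n
end PartTwo

open IsLocalRing

section PartThree
variable {R : Type*} [CommRing R] [IsDomain R] [IsDiscreteValuationRing R]
variable {F : Type*} [Field F] [Algebra R F] [IsFractionRing R F]

lemma TrivLevel.mono {j k : ℕ} (h : j ≤ k) {η : Fˣ →* ℂˣ} (hη : TrivLevel R F j η) :
    TrivLevel R F k η := fun u hu => hη u (Ideal.pow_le_pow_right h hu)

variable [TopologicalSpace R] [IsTopologicalRing R] [CompactSpace R] [T2Space R]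

lemma card_residue_gt : 1 < Nat.card (R ⧸ maximalIdeal R) := by
  borelize R
  exact one_lt_card

lemma key_hasSum (n : ℕ) (hn : 0 < n) (hroots : ∃ ζ : R, IsPrimitiveRoot ζ n) (q : ℕ)
    (hq : q = Nat.card (R ⧸ maximalIdeal R)) :
    HasSum (fun k : ℕ => (torsCount R n (k + 1) : ℝ) * ((q : ℝ)⁻¹) ^ (k + 1))
      (n * ((q : ℝ)⁻¹ * (1 - (q : ℝ)⁻¹)⁻¹)) := by
  have hq1 : 1 < q := hq ▸ card_residue_gt
  have h := key_sum (R := R) n hn hroots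
  rw [← hq, ENNReal.tsum_geometric_add_one] at h
  have hlt : (q : ENNReal)⁻¹ < 1 := by
    rw [ENNReal.inv_lt_one]; exact_mod_cast hq1
  have hne : (n : ENNReal) * ((q : ENNReal)⁻¹ * (1 - (q : ENNReal)⁻¹)⁻¹) ≠ ⊤ := by
    refine ENNReal.mul_ne_top (ENNReal.natCast_ne_top n) (ENNReal.mul_ne_top hlt.ne_top ?_)
    rw [ENNReal.inv_ne_top]
    exact (tsub_pos_of_lt hlt).ne'
  have h2 := ENNReal.hasSum_toReal (h ▸ hne)
  rw [← ENNReal.tsum_toReal_eq, h] at h2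
  · convert h2 using 1
    · ext k
      simp
    · rw [ENNReal.toReal_mul, ENNReal.toReal_mul, ENNReal.toReal_inv, ENNReal.toReal_inv,
        ENNReal.toReal_sub_of_le hlt.le ENNReal.one_ne_top, ENNReal.toReal_inv]
      simp
  · intro k
    exact ENNReal.ne_top_of_tsum_ne_top (h ▸ hne) k

lemma hasSum_tail (r : ℝ) (h0 : 0 ≤ r) (h1 : r < 1) (e : ℕ) (he : 1 ≤ e) :
    HasSum (fun k : ℕ => if e ≤ k + 1 then r ^ (k + 1) else 0) (r ^ e * (1 - r)⁻¹) := by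
  obtain ⟨e, rfl⟩ := Nat.exists_eq_add_of_le' he
  have := (hasSum_geometric_of_lt_one h0 h1).mul_left (r ^ (e + 1))
  rw [← hasSum_nat_add_iff' e]
  rw [Finset.sum_eq_zero]
  · rw [sub_zero]
    have hfun : (fun k : ℕ => if e + 1 ≤ k + e + 1 then r ^ (k + e + 1) else 0) =
        fun k => r ^ (e + 1) * r ^ k := by
      ext k
      rw [if_pos (by omega)]
      ring
    rw [hfun]
    exact this
  · intro i hi
    rw [Finset.mem_range] at hi
    rw [if_neg (by omega)]

lemma assembly (n : ℕ) (hn : 0 < n) (hroots : ∃ ζ : R, IsPrimitiveRoot ζ n) (q : ℕ)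
    (hq : q = Nat.card (R ⧸ maximalIdeal R))
    (hK : ∃ K, ∀ η : Fˣ →* ℂˣ, η ^ n = 1 → TrivLevel R F K η)
    (S : Set (Fˣ →* ℂˣ)) (hS : ∀ η, η ∈ S ↔ η ^ n = 1 ∧ ¬ TrivLevel R F 0 η)
    (e : (Fˣ →* ℂˣ) → ℕ) (he : ∀ η ∈ S, e η = sInf {k : ℕ | 1 ≤ k ∧ TrivLevel R F k η}) :
    S.Finite ∧ ∑ᶠ η ∈ S, ((q : ℝ) ^ e η)⁻¹ = (n : ℝ) * ((n : ℝ) - 1) * (q : ℝ)⁻¹ := by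
  classical
  have hq1 : 1 < q := hq ▸ card_residue_gt
  have hqR : (1 : ℝ) < q := by exact_mod_cast hq1
  have hfq : ∀ k, Finite (R ⧸ maximalIdeal R ^ k) := fun k =>
    Ideal.finite_quotient_pow (IsNoetherian.noetherian _) _
  obtain ⟨K, hK⟩ := hK
  have hXf : {η : Fˣ →* ℂˣ | η ^ n = 1}.Finite := by
    have := (char_count (R := R) (F := F) n hn K).1
    refine Set.Finite.subset (s := {η : Fˣ →* ℂˣ | η ^ n = 1 ∧ TrivLevel R F K η}) this ?_
    intro η hη
    exact ⟨hη, hK η hη⟩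
  have hSf : S.Finite := hXf.subset fun η h => ((hS η).1 h).1
  refine ⟨hSf, ?_⟩
  rw [finsum_mem_eq_finite_toFinset_sum _ hSf]
  let X := hXf.toFinset
  have hcard : ∀ k, (X.filter (fun η => TrivLevel R F k η)).card = n * torsCount R n k := by
    intro k
    rw [← (char_count (R := R) (F := F) n hn k).2]
    symm
    apply Nat.subtype_card
    intro η
    simp [X]
  have hcard0 : (X.filter (fun η => TrivLevel R F 0 η)).card = n := by
    rw [hcard]
    have : Subsingleton (R ⧸ maximalIdeal R ^ 0) := by
      rw [pow_zero, Ideal.one_eq_top]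
      exact Ideal.Quotient.subsingleton_iff.2 rfl
    have : torsCount R n 0 = 1 := by
      unfold torsCount
      rw [Nat.card_eq_one_iff_unique]
      refine ⟨⟨fun a b => Subtype.ext (Units.ext (Subsingleton.elim _ _))⟩, ⟨⟨1, one_pow _⟩⟩⟩
    rw [this, mul_one]
  have hSk : ∀ k, ((hSf.toFinset.filter (fun η => TrivLevel R F k η)).card : ℝ) =
      n * torsCount R n k - n := by
    intro k
    have hu : X.filter (fun η => TrivLevel R F k η) =
        (hSf.toFinset.filter (fun η => TrivLevel R F k η)) ∪ X.filter (fun η => TrivLevel R F 0 η) := by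
      ext η
      simp only [X, Finset.mem_filter, Finset.mem_union, Set.Finite.mem_toFinset, hS,
        Set.mem_ofPred_eq]
      have := TrivLevel.mono (R := R) (F := F) (Nat.zero_le k) (η := η)
      tauto
    have hd : Disjoint (hSf.toFinset.filter (fun η => TrivLevel R F k η))
        (X.filter (fun η => TrivLevel R F 0 η)) := by
      rw [Finset.disjoint_left]
      intro η h1 h2
      simp only [X, Finset.mem_filter, Set.Finite.mem_toFinset, hS] at h1 h2
      exact h1.1.2 h2.2
    have := hcard k
    rw [hu, Finset.card_union_of_disjoint hd, hcard0] at this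
    rw [eq_sub_iff_add_eq]
    exact_mod_cast this
  have hel : ∀ η ∈ S, 1 ≤ e η ∧ ∀ k, (e η ≤ k + 1 ↔ TrivLevel R F (k + 1) η) := by
    intro η hη
    have hne : {k : ℕ | 1 ≤ k ∧ TrivLevel R F k η}.Nonempty :=
      ⟨K + 1, by omega, (hK η ((hS η).1 hη).1).mono (by omega)⟩
    have hmem := Nat.sInf_mem hne
    rw [← he η hη] at hmem
    refine ⟨hmem.1, fun k => ⟨fun h => hmem.2.mono h, fun h => ?_⟩⟩
    rw [he η hη]
    exact Nat.sInf_le ⟨by omega, h⟩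
  have hr0 : 0 ≤ (q : ℝ)⁻¹ := by positivity
  have hr1 : (q : ℝ)⁻¹ < 1 := inv_lt_one_of_one_lt₀ hqR
  have H1 : HasSum (fun k : ℕ => ∑ η ∈ hSf.toFinset,
      if e η ≤ k + 1 then ((q : ℝ)⁻¹) ^ (k + 1) else 0)
      (∑ η ∈ hSf.toFinset, ((q : ℝ)⁻¹) ^ e η * (1 - (q : ℝ)⁻¹)⁻¹) := by
    apply hasSum_sum
    intro η hη
    exact hasSum_tail _ hr0 hr1 _ (hel η (by simpa using hη)).1
  have H2 : HasSum (fun k : ℕ => (n : ℝ) * ((torsCount R n (k + 1) : ℝ) * ((q : ℝ)⁻¹) ^ (k + 1))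
      - n * ((q : ℝ)⁻¹) ^ (k + 1))
      (n * (n * ((q : ℝ)⁻¹ * (1 - (q : ℝ)⁻¹)⁻¹)) - n * ((q : ℝ)⁻¹ * (1 - (q : ℝ)⁻¹)⁻¹)) := by
    refine ((key_hasSum n hn hroots q hq).mul_left _).sub (HasSum.mul_left _ ?_)
    have := hasSum_tail _ hr0 hr1 1 le_rfl
    simpa using this
  have H3 : (fun k : ℕ => ∑ η ∈ hSf.toFinset,
      if e η ≤ k + 1 then ((q : ℝ)⁻¹) ^ (k + 1) else 0) =
      (fun k : ℕ => (n : ℝ) * ((torsCount R n (k + 1) : ℝ) * ((q : ℝ)⁻¹) ^ (k + 1))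
      - n * ((q : ℝ)⁻¹) ^ (k + 1)) := by
    ext k
    rw [← Finset.sum_filter, Finset.sum_const, nsmul_eq_mul]
    have : hSf.toFinset.filter (fun η => e η ≤ k + 1) =
        hSf.toFinset.filter (fun η => TrivLevel R F (k + 1) η) := by
      apply Finset.filter_congr
      intro η hη
      exact (hel η (by simpa using hη)).2 k
    rw [this, hSk]
    ring
  rw [H3] at H1
  have H4 := H1.unique H2
  rw [← Finset.sum_mul] at H4
  have hne : (1 - (q : ℝ)⁻¹) ≠ 0 := by linarith
  have H5 : ∑ η ∈ hSf.toFinset, ((q : ℝ)⁻¹) ^ e η = (n : ℝ) * ((n : ℝ) - 1) * (q : ℝ)⁻¹ := by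
    apply mul_right_cancel₀ (inv_ne_zero hne)
    rw [H4]; ring
  rw [← H5]
  simp
end PartThree

open IsLocalRing Topology

section PartFour

lemma conv_unram {F : Type*} [Field F] (O : Subring F) [IsDomain O] [IsDiscreteValuationRing O] (η : Fˣ →* ℂˣ) :
    IsUnramifiedChar O η ↔ TrivLevel O F 0 η := by
  constructor
  · intro h u _
    refine h _ u.1.2 ?_
    rw [← map_inv]
    exact (u⁻¹).1.2
  · intro h u hu hu'
    have := h ⟨⟨u, hu⟩, ⟨_, hu'⟩, Subtype.ext (by simp), Subtype.ext (by simp)⟩ (by simp)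
    rw [← this]
    congr 1

lemma conv_triv {F : Type*} [Field F] (O : Subring F) [IsDomain O] [IsDiscreteValuationRing O] (η : Fˣ →* ℂˣ) (k : ℕ)
    (hk : 1 ≤ k) : TrivOnOneAdd (maximalIdeal O) k η ↔ TrivLevel O F k η := by
  constructor
  · intro h u hu
    exact h _ ⟨_, hu, rfl⟩
  · rintro h u ⟨m, hm, hmu⟩
    have hm1 : m ∈ maximalIdeal O := Ideal.pow_le_self (by omega) hm
    have hunit : IsUnit (1 + m) := by
      by_contra hc
      have h1 : (1 + m) ∈ maximalIdeal O := (mem_maximalIdeal _).2 hc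
      have h2 : (1 : O) ∈ maximalIdeal O := by simpa using sub_mem h1 hm1
      exact (Ideal.ne_top_iff_one _).1 (Ideal.IsPrime.ne_top inferInstance) h2
    obtain ⟨v, hv⟩ := hunit
    have := h v (by rw [hv]; simpa using hm)
    rw [← this]
    congr 1
    ext
    change (u : F) = ((v : O) : F)
    rw [hv]
    push_cast
    rw [hmu]; ring

variable (p : ℕ) [Fact p.Prime] (F : Type*) [NontriviallyNormedField F] [CompleteSpace F]
  [NormedAlgebra ℚ_[p] F] [FiniteDimensional ℚ_[p] F] [Algebra ℤ_[p] F]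
  [IsScalarTower ℤ_[p] ℚ_[p] F]

lemma isCompact_intClosure : IsCompact ((integralClosure ℤ_[p] F : Subalgebra ℤ_[p] F) : Set F) := by
  have hfin : Module.Finite ℤ_[p] (integralClosure ℤ_[p] F) :=
    IsIntegralClosure.finite ℤ_[p] ℚ_[p] F _
  have hfg : (Subalgebra.toSubmodule (integralClosure ℤ_[p] F)).FG := Module.Finite.iff_fg.1 hfin
  obtain ⟨d, b, hb⟩ := Submodule.fg_iff_exists_fin_generating_family.1 hfg
  have : ((integralClosure ℤ_[p] F : Subalgebra ℤ_[p] F) : Set F) =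
      Set.range (fun c : Fin d → ℤ_[p] => ∑ i, c i • b i) := by
    ext x
    rw [Set.mem_range, ← Submodule.mem_span_range_iff_exists_fun, hb]
    rfl
  rw [this]
  apply isCompact_range
  refine continuous_finsetSum _ fun i _ => ?_
  have h : ∀ c : Fin d → ℤ_[p], c i • b i = ((c i : ℚ_[p])) • b i := by
    intro c
    rw [← IsScalarTower.algebraMap_smul ℚ_[p] (c i) (b i)]
    rfl
  simp_rw [h]
  fun_prop

lemma main_normed (n : ℕ) (hn0 : 0 < n) (hroots : ∃ ζ : F, IsPrimitiveRoot ζ n)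
    (O : Subring F) (hO : O = (integralClosure ℤ_[p] F).toSubring)
    (𝔪 : Ideal O) (h𝔪 : ∀ x : O, x ∈ 𝔪 ↔ ¬IsUnit x)
    (q : ℕ) (hq : q = Nat.card (O ⧸ 𝔪)) :
    {η : Fˣ →* ℂˣ | η ^ n = 1 ∧ ¬IsUnramifiedChar O η}.Finite ∧
    ∑ᶠ η ∈ {η : Fˣ →* ℂˣ | η ^ n = 1 ∧ ¬IsUnramifiedChar O η},
        ((q : ℝ) ^ conductorChar O 𝔪 η)⁻¹ = (n : ℝ) * ((n : ℝ) - 1) * (q : ℝ)⁻¹ := by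
  have hfr : IsFractionRing O F := by
    subst hO
    exact IsIntegralClosure.isFractionRing_of_finite_extension ℤ_[p] ℚ_[p] F
      (integralClosure ℤ_[p] F)
  have hded : IsDedekindDomain O := by
    subst hO
    exact integralClosure.isDedekindDomain ℤ_[p] ℚ_[p] F
  have hnf : ¬ IsField O := by
    subst hO
    intro h
    have hi : Function.Injective (algebraMap ℤ_[p] F) := by
      rw [IsScalarTower.algebraMap_eq ℤ_[p] ℚ_[p] F]
      exact (algebraMap ℚ_[p] F).injective.comp (IsFractionRing.injective ℤ_[p] ℚ_[p])
    have hi2 : Function.Injective (algebraMap ℤ_[p] (integralClosure ℤ_[p] F)) := by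
      intro a b hab
      exact hi (congrArg Subtype.val hab)
    have h2 : IsField ℤ_[p] :=
      isField_of_isIntegral_of_isField (S := integralClosure ℤ_[p] F) hi2 h
    exact IsDiscreteValuationRing.not_isField ℤ_[p] h2
  have hloc : IsLocalRing O := by
    apply IsLocalRing.of_nonunits_add
    intro a b ha hb
    exact (h𝔪 _).1 (𝔪.add_mem ((h𝔪 a).2 ha) ((h𝔪 b).2 hb))
  have hmax : 𝔪 = maximalIdeal O := by
    ext x; rw [h𝔪, mem_maximalIdeal]; rfl
  subst hmax
  have hdvr : IsDiscreteValuationRing O := ((IsDiscreteValuationRing.TFAE O hnf).out 0 2).2 hded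
  have hcomp : CompactSpace O := by
    subst hO
    exact isCompact_iff_compactSpace.1 (isCompact_intClosure p F)
  have hrO : ∃ ζ : O, IsPrimitiveRoot ζ n := by
    obtain ⟨ζ, hζ⟩ := hroots
    have hmem : ζ ∈ O := by
      subst hO
      exact (hζ.isIntegral hn0).tower_top
    refine ⟨⟨ζ, hmem⟩, ?_⟩
    exact IsPrimitiveRoot.of_map_of_injective (f := O.subtype) hζ Subtype.val_injective
  refine assembly (R := O) (F := F) n hn0 hrO q hq ?_ _ (fun η => ?_) _ (fun η hη => ?_)
  · -- eventually all units near 1 are n-th powers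
    have hchar : CharZero F := charZero_of_injective_algebraMap (algebraMap ℚ_[p] F).injective
    have hd := hasStrictDerivAt_pow n (1 : F)
    have hnh := hd.map_nhds_eq (by simpa using hn0.ne')
    rw [one_pow] at hnh
    have hrange : Set.range (fun x : F => x ^ n) ∈ 𝓝 (1 : F) := by
      rw [← hnh]; exact Filter.range_mem_map
    have hcont : Continuous (fun y : O => (1 : F) + y) := by fun_prop
    have hU : (fun y : O => (1 : F) + y) ⁻¹' Set.range (fun x : F => x ^ n) ∈ 𝓝 (0 : O) := by
      apply hcont.continuousAt.preimage_mem_nhds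
      simpa using hrange
    have hant : Antitone (fun k : ℕ => ((maximalIdeal O ^ k : Ideal O) : Set O)) :=
      fun i j hij => Ideal.pow_le_pow_right hij
    have hclosed : ∀ k : ℕ, IsClosed ((maximalIdeal O ^ k : Ideal O) : Set O) := fun k =>
      (maximalIdeal O ^ k).toAddSubgroup.isClosed_of_isOpen (isOpen_maximalIdeal_pow O k)
    obtain ⟨K, hK⟩ := exists_subset_nhds_of_isCompact (hant.directed_ge)
      (fun k => (hclosed k).isCompact) (U := (fun y : O => (1 : F) + y) ⁻¹' Set.range (fun x : F => x ^ n))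
      (by
        intro x hx
        have hx0 : x ∈ (⨅ k : ℕ, maximalIdeal O ^ k : Ideal O) := by
          simpa [Ideal.mem_iInf] using hx
        rw [Ideal.iInf_pow_eq_bot_of_isLocalRing _ (Ideal.IsPrime.ne_top inferInstance)] at hx0
        rw [Ideal.mem_bot] at hx0
        rw [hx0]; exact hU)
    refine ⟨K, fun η hη u hu => ?_⟩
    obtain ⟨x, hx⟩ := hK hu
    have hx' : x ^ n = ((u : O) : F) := by
      simpa using hx
    have hx0 : x ≠ 0 := by
      rintro rfl
      rw [zero_pow hn0.ne'] at hx'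
      apply u.ne_zero
      exact Subtype.ext hx'.symm
    have : unitsEmb O F u = (Units.mk0 x hx0) ^ n := by
      ext
      rw [Units.val_pow_eq_pow_val, Units.val_mk0, hx']
      rfl
    rw [this, map_pow, ← MonoidHom.pow_apply, hη]
    rfl
  · rw [← conv_unram]; rfl
  · unfold conductorChar
    rw [if_neg hη.2]
    congr 1
    ext k
    simp only [Set.mem_ofPred_eq]
    exact and_congr_right fun hk => conv_triv O η k hk

end PartFour

/-- Let `n` be an odd positive integer and `F` a finite extension of `ℚ_p` containing `n`
distinct `n`-th roots of unity, with ring of integers `O`, maximal ideal `𝔪` and residue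
field of cardinality `q`. Then the set of ramified characters `η` of `Fˣ` with `ηⁿ = 1` is
finite, and the sum of `q^{-e(η)}` over that set equals `n(n-1) q⁻¹`. -/
theorem stmt9 (p : ℕ) [Fact p.Prime] (n : ℕ) (hn : Odd n) (hn0 : 0 < n)
    (F : Type*) [Field F] [Algebra ℚ_[p] F] [FiniteDimensional ℚ_[p] F]
    (hroots : ∃ ζ : F, IsPrimitiveRoot ζ n)
    (O : Subring F) (hO : O = ringOfInt p F)
    (𝔪 : Ideal O) (h𝔪 : ∀ x : O, x ∈ 𝔪 ↔ ¬IsUnit x)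
    (q : ℕ) (hq : q = Nat.card (O ⧸ 𝔪)) :
    {η : Fˣ →* ℂˣ | η ^ n = 1 ∧ ¬IsUnramifiedChar O η}.Finite ∧
    ∑ᶠ η ∈ {η : Fˣ →* ℂˣ | η ^ n = 1 ∧ ¬IsUnramifiedChar O η},
        ((q : ℝ) ^ conductorChar O 𝔪 η)⁻¹ = (n : ℝ) * ((n : ℝ) - 1) * (q : ℝ)⁻¹ := by
  let i1 : NontriviallyNormedField F := spectralNorm.nontriviallyNormedField ℚ_[p] F
  let i2 : NormedAlgebra ℚ_[p] F := spectralNorm.normedAlgebra ℚ_[p] F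
  have i3 : CompleteSpace F := spectralNorm.completeSpace ℚ_[p] F
  let i4 : Algebra ℤ_[p] F :=
    ((algebraMap ℚ_[p] F).comp (algebraMap ℤ_[p] ℚ_[p])).toAlgebra
  have i5 : IsScalarTower ℤ_[p] ℚ_[p] F := IsScalarTower.of_algebraMap_eq fun _ => rfl
  exact main_normed p F n hn0 hroots O hO 𝔪 h𝔪 q hq
end
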